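/- Let k be a field, let G be a locally indicable group admitting a Hughes-free embedding φ : kG → D into a division ring D, and let H ≤ G be a subgroup of finite index. Let E be the division closure of φ(kH) in D (so that the corestricted map kH → E is a Hughes-free embedding of kH). Then for every p ≥ 0, |G : H| · dim_D H_p(G; D) = dim_E H_p(H; E), where H_p(G; D) is the p-th group homology of G with coefficients in D (a left kG-module via φ) and H_p(H; E) is the p-th group homology of H with coefficients in E (a left kH-module via φ), the dimensions being taken with respect to the right D- (respectively right E-) vector space structures induced by right multiplication on the coefficient module (an equality of extended natural numbers). -/

import Mathlib

/-- A subring `S` of a ring `R` is a *division subring* if every nonzero element of `S`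
has a two-sided inverse lying in `S`. -/
def IsDivisionSubring {R : Type*} [Ring R] (S : Subring R) : Prop :=
  ∀ x ∈ S, x ≠ 0 → ∃ y ∈ S, x * y = 1 ∧ y * x = 1

/-- The *division closure* of a subset `s` of a ring `R`: the smallest division subring
of `R` containing `s` (realized as the infimum of all division subrings containing `s`). -/
def divisionClosure {R : Type*} [Ring R] (s : Set R) : Subring R :=
  sInf {S : Subring R | IsDivisionSubring S ∧ s ⊆ S}

lemma subset_divisionClosure {R : Type*} [Ring R] (s : Set R) :
    s ⊆ (divisionClosure s : Set R) := fun _x hx =>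
  Subring.mem_sInf.2 fun _S hS => hS.2 hx

/-- Integer powers of an element of a ring, using `Ring.inverse` for negative exponents.
When the ambient ring is a division ring this agrees with the usual `zpow`. -/
noncomputable def ringZPow {R : Type*} [Ring R] (x : R) (i : ℤ) : R :=
  if 0 ≤ i then x ^ i.toNat else (Ring.inverse x) ^ (-i).toNat

/-- A group is *locally indicable* if every nontrivial finitely generated subgroup
admits a surjective homomorphism onto `ℤ`. -/
def LocallyIndicable (G : Type*) [Group G] : Prop :=
  ∀ H : Subgroup G, H ≠ ⊥ → H.FG →
    ∃ f : H →* Multiplicative ℤ, Function.Surjective f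

/-- `φ : kG →+* D` is a *Hughes-free embedding* if it is injective, the division closure
of its image is all of `D`, and whenever `H ≤ G` is finitely generated, `K ⊴ H` and
`t ∈ H` are such that `H/K` is infinite cyclic generated by `tK`, the integer powers of
`φ t` are left linearly independent over the division closure of `φ (kK)` in `D`. -/
def IsHughesFreeEmbedding {k : Type*} [DivisionRing k] {G : Type*} [Group G]
    {D : Type*} [Ring D] (φ : MonoidAlgebra k G →+* D) : Prop :=
  Function.Injective φ ∧
  divisionClosure (Set.range φ) = ⊤ ∧
  ∀ (H : Subgroup G), H.FG → ∀ (K : Subgroup H) (t : H),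
    (∃ f : H →* Multiplicative ℤ,
        Function.Surjective f ∧ f.ker = K ∧ f t = Multiplicative.ofAdd 1) →
    ∀ c : ℤ →₀ D,
      (∀ i : ℤ, c i ∈ divisionClosure
          (Set.range (φ.comp (MonoidAlgebra.mapDomainRingHom k (H.subtype.comp K.subtype))))) →
      (c.sum fun i a => a * ringZPow (φ (MonoidAlgebra.of k G (H.subtype t))) i) = 0 →
      c = 0

/-- A topological space is a *3-manifold* if it is nonempty, connected, Hausdorff,
second countable, and every point has an open neighbourhood homeomorphic to `ℝ³`. -/
def Is3Manifold (M : Type*) [TopologicalSpace M] : Prop :=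
  Nonempty M ∧ ConnectedSpace M ∧ T2Space M ∧ SecondCountableTopology M ∧
    ∀ x : M, ∃ U : Set M, IsOpen U ∧ x ∈ U ∧ Nonempty (U ≃ₜ (Fin 3 → ℝ))

section BarComplex

variable {Γ : Type*} [Group Γ] {D : Type*} [Ring D]

/-- Left multiplication by a fixed element, as a linear map of right `D`-modules. -/
def lmulLeft (x : D) : D →ₗ[Dᵐᵒᵖ] D where
  toFun d := x * d
  map_add' := mul_add x
  map_smul' a d := by
    simp only [MulOpposite.smul_eq_mul_unop, RingHom.id_apply, mul_assoc]

/-- The `i`-th inner face map of the inhomogeneous bar complex: it multiplies the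
`i`-th and `(i+1)`-st entries together. -/
def barFace {n : ℕ} (i : Fin n) (g : Fin (n + 1) → Γ) : Fin n → Γ := fun j =>
  if (j : ℕ) < (i : ℕ) then g (Fin.castSucc j)
  else if j = i then g (Fin.castSucc j) * g j.succ
  else g j.succ

/-- The summand of the bar differential corresponding to a basis element `g`. -/
noncomputable def barTerm (σ : Γ → D) {n : ℕ} (g : Fin (n + 1) → Γ) :
    D →ₗ[Dᵐᵒᵖ] ((Fin n → Γ) →₀ D) :=
  (Finsupp.lsingle (fun j : Fin n => g j.succ)).comp (lmulLeft (σ ((g 0)⁻¹)))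
    + ∑ i : Fin n,
        (Finsupp.lsingle (barFace i g)).comp (lmulLeft ((-1 : D) ^ ((i : ℕ) + 1)))
    + (Finsupp.lsingle (fun j : Fin n => g (Fin.castSucc j))).comp
        (lmulLeft ((-1 : D) ^ (n + 1)))

/-- The differential of the inhomogeneous bar complex computing the group homology of
`Γ` with coefficients in the left `Γ`-module `D` (the action of `g ∈ Γ` being left
multiplication by `σ g`), as a map of right `D`-modules. -/
noncomputable def barBoundary (σ : Γ → D) (n : ℕ) :
    ((Fin (n + 1) → Γ) →₀ D) →ₗ[Dᵐᵒᵖ] ((Fin n → Γ) →₀ D) :=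
  Finsupp.lsum ℕ fun g => barTerm σ g

/-- The cycles of the bar complex. -/
noncomputable def barCycles (σ : Γ → D) : (p : ℕ) → Submodule Dᵐᵒᵖ ((Fin p → Γ) →₀ D)
  | 0 => ⊤
  | (n + 1) => LinearMap.ker (barBoundary σ n)

/-- The dimension, as a right `D`-vector space, of the `p`-th group homology of `Γ`
with coefficients in the left `Γ`-module `D`: the rank of the image of the cycles in
the quotient of the chains by the boundaries. -/
noncomputable def barHomologyRank (σ : Γ → D) (p : ℕ) : Cardinal :=
  Module.rank Dᵐᵒᵖ
    ↥(Submodule.map (LinearMap.range (barBoundary σ p)).mkQ (barCycles σ p))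

end BarComplex

lemma apply_of_mem_divisionClosure {k : Type u} [Field k] {G : Type v} [Group G]
    {D : Type w} [DivisionRing D] (φ : MonoidAlgebra k G →+* D)
    (H : Subgroup G) (h : H) :
    φ (MonoidAlgebra.of k G (h : G)) ∈
      divisionClosure (Set.range (φ.comp (MonoidAlgebra.mapDomainRingHom k H.subtype))) := by
  apply subset_divisionClosure
  refine ⟨MonoidAlgebra.of k H h, ?_⟩
  simp [MonoidAlgebra.of_apply, MonoidAlgebra.mapDomainRingHom_apply,
    Finsupp.mapDomain_single]

/-- Complexities: finitely supported multisets of ordinals, ordered colexicographically. -/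
abbrev Cplx : Type 1 := Colex (Ordinal.{0} →₀ ℕ)

namespace Cplx

/-- The ordinal with Cantor normal form given by a complexity. -/
noncomputable def val (a : Cplx) : Ordinal.{0} :=
  Ordinal.CNF.eval Ordinal.omega0
    ((ofColex a).mapRange (fun n : ℕ => (n : Ordinal.{0})) Nat.cast_zero)

lemma eval_split (f : Ordinal.{0} →₀ Ordinal.{0}) (i : Ordinal.{0}) :
    Ordinal.CNF.eval Ordinal.omega0 f =
      Ordinal.CNF.eval Ordinal.omega0 (f.filter (fun j => i < j)) +
      (Ordinal.omega0 ^ i * f i +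
        Ordinal.CNF.eval Ordinal.omega0 (f.filter (fun j => j < i))) := by
  have h2 : f = f.filter (fun j => i < j) + (Finsupp.single i (f i) + f.filter (fun j => j < i)) := by
    ext j
    rcases lt_trichotomy i j with h | h | h
    · simp [h, h.not_gt, h.ne]
    · subst h; simp
    · simp [h, h.not_gt, h.ne']
  conv_lhs => rw [h2]
  rw [Ordinal.CNF.eval_add, Ordinal.CNF.eval_single_add']
  · intro e he
    simp at he; exact he.2
  · intro e₁ h₁ e₂ h₂
    simp only [Finsupp.support_filter, Finset.mem_filter] at h₁
    have := Finsupp.support_add h₂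
    simp only [Finset.mem_union, Finsupp.support_filter, Finset.mem_filter] at this
    rcases this with h | h
    · have := Finsupp.support_single_subset h
      simp at this; subst this; exact h₁.2.le
    · exact (h.2.trans h₁.2).le

lemma val_strictMono : StrictMono val := by
  intro a b hab
  obtain ⟨i, hi, hlt⟩ := Finsupp.Colex.lt_iff.1 hab
  unfold val
  rw [eval_split _ i, eval_split (Finsupp.mapRange _ _ (ofColex b)) i]
  have : ((ofColex a).mapRange (fun n : ℕ => (n : Ordinal.{0})) Nat.cast_zero).filter
      (fun j => i < j) = ((ofColex b).mapRange (fun n : ℕ => (n : Ordinal.{0}))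
        Nat.cast_zero).filter (fun j => i < j) := by
    ext j
    by_cases h : i < j
    · simp only [Finsupp.filter_apply, h, if_true, Finsupp.mapRange_apply]
      exact congrArg _ (hi j h)
    · simp [h]
  rw [this]
  refine add_lt_add_right ?_ _
  refine lt_of_lt_of_le ?_ (le_add_right le_rfl)
  have hl : Ordinal.CNF.eval Ordinal.omega0 (((ofColex a).mapRange
      (fun n : ℕ => (n : Ordinal.{0})) Nat.cast_zero).filter (fun j => j < i)) <
      Ordinal.omega0 ^ i := by
    apply Ordinal.CNF.eval_lt
    · intro e
      by_cases h : e < i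
      · simp [h]
      · simp [h, Ordinal.omega0_pos]
    · intro e he
      simp at he; exact he.2
  calc _ < Ordinal.omega0 ^ i * ((ofColex a i : ℕ) : Ordinal.{0}) + Ordinal.omega0 ^ i := by
        simp only [Finsupp.mapRange_apply]
        exact add_lt_add_right hl _
    _ = Ordinal.omega0 ^ i * ((ofColex a i + 1 : ℕ) : Ordinal.{0}) := by
        push_cast; rw [mul_add, mul_one]
    _ ≤ _ := by
        simp only [Finsupp.mapRange_apply]
        refine mul_le_mul_right ?_ _
        exact_mod_cast hlt

/-- An additively indecomposable complexity exceeding a given complexity. -/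
noncomputable def w (a : Cplx) : Cplx := toColex (Finsupp.single (val a + 1) 1)

lemma w_strictMono : StrictMono w := fun _ _ h =>
  Finsupp.Colex.single_strictMono (by
    simpa only [← Order.succ_eq_add_one, Order.succ_lt_succ_iff] using val_strictMono h)

lemma lt_w_iff {a x : Cplx} : x < w a ↔ ∀ j, val a + 1 ≤ j → ofColex x j = 0 := by
  have hw : ofColex (w a) (val a + 1) = 1 := Finsupp.single_eq_same
  constructor
  · intro h j hj
    obtain ⟨i, hi, hlt⟩ := Finsupp.Colex.lt_iff.1 h
    have h1 : i = val a + 1 := by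
      by_contra hne
      have : ofColex (w a) i = 0 := Finsupp.single_eq_of_ne hne
      omega
    subst h1
    rcases hj.eq_or_lt with rfl | hj
    · show ofColex x (val a + 1) = 0
      omega
    · exact (hi j hj).trans (Finsupp.single_eq_of_ne hj.ne')
  · intro h
    refine Finsupp.Colex.lt_iff.2 ⟨val a + 1, fun j hj => ?_, ?_⟩
    · exact (h j hj.le).trans (Finsupp.single_eq_of_ne hj.ne').symm
    · have := h _ le_rfl
      rw [hw]
      show ofColex x (val a + 1) < 1
      omega

lemma w_pos (a : Cplx) : 0 < w a := lt_w_iff.2 fun _ _ => rfl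

lemma add_lt_w {a x y : Cplx} (hx : x < w a) (hy : y < w a) : x + y < w a := by
  rw [lt_w_iff] at *
  intro j hj
  have h1 := hx j hj
  have h2 := hy j hj
  show ofColex x j + ofColex y j = 0
  omega

lemma lt_w (a : Cplx) : a < w a := by
  have h : StrictMono fun a : Cplx => (toColex (Finsupp.single (val a) 1) : Cplx) :=
    fun _ _ h => Finsupp.Colex.single_strictMono (val_strictMono h)
  refine (h.le_apply (x := a)).trans_lt (Finsupp.Colex.single_strictMono ?_)
  exact Order.lt_succ _ |>.trans_eq (Order.succ_eq_add_one _)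

lemma zero_le (a : Cplx) : 0 ≤ a := by
  rw [← not_lt]
  intro h
  obtain ⟨i, -, hlt⟩ := Finsupp.Colex.lt_iff.1 h
  exact absurd hlt (Nat.not_lt_zero _)

end Cplx

namespace Cplx

section Complexity

variable {k : Type*} [Field k] {G : Type*} [Group G] {A : Type*} [Ring A]

/-- Elements of the rational closure of `k[L]` in `A`, with a complexity. The flag `true`
marks monomials, the flag `false` marks sums of monomials. -/
inductive Cx (κ : k →+* A) (ψ : G →* A) (L : Subgroup G) : Bool → Cplx → A → Prop
  | unit (c : k) (g : G) (hg : g ∈ L) : Cx κ ψ L true 0 (κ c * ψ g)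
  | mul {α β : Cplx} {x y : A} : Cx κ ψ L true α x → Cx κ ψ L true β y →
      Cx κ ψ L true (α + β) (x * y)
  | inv {a : Cplx} {x y : A} : Cx κ ψ L false a x → x * y = 1 → y * x = 1 →
      Cx κ ψ L true (w a) y
  | atom {α : Cplx} {x : A} : Cx κ ψ L true α x → Cx κ ψ L false (w α) x
  | add {α b : Cplx} {x y : A} : Cx κ ψ L true α x → Cx κ ψ L false b y →
      Cx κ ψ L false (w α + b) (x + y)

variable {κ : k →+* A} {ψ : G →* A} {L K : Subgroup G}

lemma map_mul_map_inv (ψ : G →* A) (g : G) : ψ g * ψ g⁻¹ = 1 := by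
  rw [← map_mul, mul_inv_cancel, map_one]

lemma map_inv_mul_map (ψ : G →* A) (g : G) : ψ g⁻¹ * ψ g = 1 := by
  rw [← map_mul, inv_mul_cancel, map_one]

namespace Cx

lemma mono (h : K ≤ L) {s : Bool} {a : Cplx} {x : A} (hx : Cx κ ψ K s a x) :
    Cx κ ψ L s a x := by
  induction hx with
  | unit c g hg => exact .unit c g (h hg)
  | mul _ _ h1 h2 => exact .mul h1 h2
  | inv _ h1 h2 h3 => exact .inv h3 h1 h2
  | atom _ h1 => exact .atom h1
  | add _ _ h1 h2 => exact .add h1 h2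

lemma conj (hκ : ∀ c g, Commute (κ c) (ψ g)) {t : G} (h : ∀ g ∈ K, t * g * t⁻¹ ∈ K)
    {s : Bool} {a : Cplx} {x : A} (hx : Cx κ ψ K s a x) :
    Cx κ ψ K s a (ψ t * x * ψ t⁻¹) := by
  have key : ∀ x y, ψ t * (x * y) * ψ t⁻¹ = (ψ t * x * ψ t⁻¹) * (ψ t * y * ψ t⁻¹) := by
    intro x y
    have := map_inv_mul_map ψ t
    calc ψ t * (x * y) * ψ t⁻¹ = ψ t * x * 1 * y * ψ t⁻¹ := by simp only [mul_one, mul_assoc]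
      _ = _ := by rw [← this]; simp only [mul_assoc]
  have one : ψ t * 1 * ψ t⁻¹ = 1 := by rw [mul_one, map_mul_map_inv]
  induction hx with
  | unit c g hg =>
    have : ψ t * (κ c * ψ g) * ψ t⁻¹ = κ c * ψ (t * g * t⁻¹) := by
      rw [← mul_assoc, ← (hκ c t).eq, map_mul, map_mul]
      simp only [mul_assoc]
    rw [this]
    exact .unit c _ (h g hg)
  | mul _ _ h1 h2 => rw [key]; exact .mul h1 h2
  | inv _ h1 h2 h3 =>
    refine .inv h3 ?_ ?_
    · rw [← key, h1, one]
    · rw [← key, h2, one]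
  | atom _ h1 => exact .atom h1
  | add _ _ h1 h2 =>
    rw [mul_add, add_mul]; exact .add h1 h2

lemma unit' {g : G} (hg : g ∈ L) : Cx κ ψ L true 0 (ψ g) := by
  simpa using Cx.unit (κ := κ) (ψ := ψ) (L := L) 1 g hg

lemma mul_unit {s : Bool} {a : Cplx} {x : A} {g : G} (hg : g ∈ L)
    (hx : Cx κ ψ L s a x) : Cx κ ψ L s a (x * ψ g) := by
  have : ∀ {a x}, Cx κ ψ L true a x → Cx κ ψ L true a (x * ψ g) := fun hx => by
    simpa using Cx.mul hx (unit' hg)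
  cases s with
  | true => exact this hx
  | false =>
    generalize hs : false = s at hx
    induction hx with
    | unit c g hg => simp at hs
    | mul _ _ h1 h2 => simp at hs
    | inv _ h1 h2 h3 => simp at hs
    | atom h _ => exact .atom (this h)
    | add h _ h1 h2 => rw [add_mul]; exact .add (this h) (h2 hs)

lemma unit_mul {s : Bool} {a : Cplx} {x : A} {g : G} (hg : g ∈ L)
    (hx : Cx κ ψ L s a x) : Cx κ ψ L s a (ψ g * x) := by
  have : ∀ {a x}, Cx κ ψ L true a x → Cx κ ψ L true a (ψ g * x) := fun hx => by
    simpa using Cx.mul (unit' hg) hx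
  cases s with
  | true => exact this hx
  | false =>
    generalize hs : false = s at hx
    induction hx with
    | unit c g hg => simp at hs
    | mul _ _ h1 h2 => simp at hs
    | inv _ h1 h2 h3 => simp at hs
    | atom h _ => exact .atom (this h)
    | add h _ h1 h2 => rw [mul_add]; exact .add (this h) (h2 hs)

lemma neg {s : Bool} {a : Cplx} {x : A} (hx : Cx κ ψ L s a x) : Cx κ ψ L s a (-x) := by
  have : ∀ {a x}, Cx κ ψ L true a x → Cx κ ψ L true a (-x) := fun hx => by
    simpa using Cx.mul (Cx.unit (κ := κ) (ψ := ψ) (L := L) (-1) 1 L.one_mem) hx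
  cases s with
  | true => exact this hx
  | false =>
    generalize hs : false = s at hx
    induction hx with
    | unit c g hg => simp at hs
    | mul _ _ h1 h2 => simp at hs
    | inv _ h1 h2 h3 => simp at hs
    | atom h _ => exact .atom (this h)
    | add h _ h1 h2 => rw [neg_add]; exact .add (this h) (h2 hs)

lemma sum_add {a b : Cplx} {x y : A} (hx : Cx κ ψ L false a x) (hy : Cx κ ψ L false b y) :
    Cx κ ψ L false (a + b) (x + y) := by
  generalize hs : false = s at hx
  induction hx with
  | unit c g hg => simp at hs
  | mul _ _ h1 h2 => simp at hs
  | inv _ h1 h2 h3 => simp at hs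
  | atom h _ => exact .add h hy
  | add h _ h1 h2 => rw [add_assoc, add_assoc]; exact .add h (h2 hs)

lemma atom_zero {α : Cplx} {x : A} (hx : Cx κ ψ L true α x) : Cx κ ψ L true α 0 := by
  simpa using Cx.mul (Cx.unit (κ := κ) (ψ := ψ) (L := L) 0 1 L.one_mem) hx

lemma zero' : Cx κ ψ L true 0 0 := atom_zero (unit' L.one_mem)

lemma w_zero_le {b : Cplx} {x : A} (hx : Cx κ ψ L false b x) : w 0 ≤ b := by
  generalize hs : false = s at hx
  have h0 : ∀ α, w 0 ≤ w α := fun α => w_strictMono.monotone (zero_le α)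
  induction hx with
  | unit c g hg => simp at hs
  | mul _ _ h1 h2 => simp at hs
  | inv _ h1 h2 h3 => simp at hs
  | atom h _ => exact h0 _
  | add h _ h1 h2 => exact (h0 _).trans (le_add_of_nonneg_right (zero_le _))

lemma sum_zero {b : Cplx} {x : A} (hx : Cx κ ψ L false b x) : Cx κ ψ L false b 0 := by
  generalize hs : false = s at hx
  induction hx with
  | unit c g hg => simp at hs
  | mul _ _ h1 h2 => simp at hs
  | inv _ h1 h2 h3 => simp at hs
  | atom h _ => exact .atom h.atom_zero
  | add h _ h1 h2 => simpa using Cx.add h.atom_zero (h2 hs)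

end Cx

variable (κ ψ K) in
/-- The additive group generated by the monomials of complexity less than `α`. -/
def below (α : Cplx) : AddSubgroup A := AddSubgroup.closure {x | ∃ β < α, Cx κ ψ K true β x}

variable (κ ψ K) in
/-- The sums of complexity less than `a`. -/
def sumsBelow (a : Cplx) : Set A := {x | ∃ b < a, Cx κ ψ K false b x}

lemma mem_sumsBelow_of_mem_below {α : Cplx} (hα : 0 < α) {x : A} (hx : x ∈ below κ ψ K α) :
    x ∈ sumsBelow κ ψ K (w α) := by
  induction hx using AddSubgroup.closure_induction with
  | mem x hx =>
    obtain ⟨β, hβ, hx⟩ := hx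
    exact ⟨w β, w_strictMono hβ, .atom hx⟩
  | zero => exact ⟨w 0, w_strictMono hα, .atom Cx.zero'⟩
  | add x y _ _ hx hy =>
    obtain ⟨b, hb, hx⟩ := hx
    obtain ⟨c, hc, hy⟩ := hy
    exact ⟨b + c, add_lt_w hb hc, hx.sum_add hy⟩
  | neg x _ hx =>
    obtain ⟨b, hb, hx⟩ := hx
    exact ⟨b, hb, hx.neg⟩

lemma mem_below_of_sum {α b : Cplx} {x : A} (hx : Cx κ ψ K false b x) (hb : b < w α) :
    x ∈ below κ ψ K α := by
  generalize hs : false = s at hx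
  induction hx with
  | unit c g hg => simp at hs
  | mul _ _ h1 h2 => simp at hs
  | inv _ h1 h2 h3 => simp at hs
  | atom h _ => exact AddSubgroup.subset_closure ⟨_, w_strictMono.lt_iff_lt.1 hb, h⟩
  | add h _ h1 h2 =>
    refine add_mem (AddSubgroup.subset_closure ⟨_, w_strictMono.lt_iff_lt.1 ?_, h⟩) (h2 ?_ hs)
    · exact (le_add_of_nonneg_right (zero_le _)).trans_lt hb
    · exact (le_add_of_nonneg_left (zero_le _)).trans_lt hb

lemma mem_below_w {a b : Cplx} {x : A} (hx : Cx κ ψ K false b x) (hb : b ≤ a) :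
    x ∈ below κ ψ K (w a) :=
  mem_below_of_sum hx (hb.trans_lt ((lt_w a).trans (lt_w _)))

lemma below_mul_aux {γ : Cplx} {s t : Set A}
    (hs : ∀ x ∈ s, ∀ y ∈ t, x * y ∈ below κ ψ K γ) {x y : A}
    (hx : x ∈ AddSubgroup.closure s) (hy : y ∈ AddSubgroup.closure t) :
    x * y ∈ below κ ψ K γ := by
  induction hx using AddSubgroup.closure_induction with
  | zero => simp
  | add x x' _ _ hx hx' => rw [add_mul]; exact add_mem hx hx'
  | neg x _ hx => rw [neg_mul]; exact neg_mem hx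
  | mem x hx =>
    induction hy using AddSubgroup.closure_induction with
    | zero => simp
    | add x x' _ _ hx hx' => rw [mul_add]; exact add_mem hx hx'
    | neg x _ hx => rw [mul_neg]; exact neg_mem hx
    | mem y hy => exact hs x hx y hy

lemma below_mul_below {α β : Cplx} {x y : A} (hx : x ∈ below κ ψ K α)
    (hy : y ∈ below κ ψ K β) : x * y ∈ below κ ψ K (α + β) := by
  refine below_mul_aux ?_ hx hy
  rintro x ⟨a, ha, hx⟩ y ⟨b, hb, hy⟩
  exact AddSubgroup.subset_closure ⟨_, add_lt_add ha hb, hx.mul hy⟩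

lemma below_mul_atom {α β : Cplx} {x y : A} (hx : x ∈ below κ ψ K α)
    (hy : Cx κ ψ K true β y) : x * y ∈ below κ ψ K (α + β) := by
  refine below_mul_aux (t := {y}) ?_ hx (AddSubgroup.subset_closure rfl)
  rintro x ⟨a, ha, hx⟩ y rfl
  exact AddSubgroup.subset_closure ⟨_, add_lt_add_left ha _, hx.mul hy⟩

lemma atom_mul_below {α β : Cplx} {x y : A} (hx : Cx κ ψ K true α x)
    (hy : y ∈ below κ ψ K β) : x * y ∈ below κ ψ K (α + β) := by
  refine below_mul_aux (s := {x}) ?_ (AddSubgroup.subset_closure rfl) hy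
  rintro x rfl y ⟨a, ha, hy⟩
  exact AddSubgroup.subset_closure ⟨_, add_lt_add_right ha _, hx.mul hy⟩

variable (κ ψ K) in
/-- Below an indecomposable complexity, the monomials generate a subring. -/
def belowRing (a : Cplx) : Subring A where
  carrier := below κ ψ K (w a)
  zero_mem' := zero_mem _
  add_mem' := add_mem
  neg_mem' := neg_mem
  one_mem' := AddSubgroup.subset_closure ⟨0, w_pos a, by simpa using Cx.unit' K.one_mem⟩
  mul_mem' := by
    intro x y hx hy
    refine below_mul_aux ?_ hx hy
    rintro x ⟨α, hα, hx⟩ y ⟨β, hβ, hy⟩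
    exact AddSubgroup.subset_closure ⟨_, add_lt_w hα hβ, hx.mul hy⟩

lemma below_conj (hκ : ∀ c g, Commute (κ c) (ψ g)) {t : G} (h : ∀ g ∈ K, t * g * t⁻¹ ∈ K)
    {α : Cplx} {x : A} (hx : x ∈ below κ ψ K α) : ψ t * x * ψ t⁻¹ ∈ below κ ψ K α := by
  induction hx using AddSubgroup.closure_induction with
  | zero => simp
  | add x x' _ _ hx hx' => rw [mul_add, add_mul]; exact add_mem hx hx'
  | neg x _ hx => rw [mul_neg, neg_mul]; exact neg_mem hx
  | mem x hx =>
    obtain ⟨β, hβ, hx⟩ := hx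
    exact AddSubgroup.subset_closure ⟨β, hβ, hx.conj hκ h⟩

end Complexity

end Cplx

namespace Cplx

section Filtration

variable {k : Type*} [Field k] {G : Type*} [Group G] {A : Type*} [Ring A]

/-- A separated filtration witnessing that the rational closure of `k[K]` and `t`
behaves like a ring of twisted Laurent series in `t`. -/
structure Filt (κ : k →+* A) (ψ : G →* A) (K : Subgroup G) (t : G) where
  /-- The filtration. -/
  V : ℤ → AddSubgroup A
  conj_mem : ∀ i : ℤ, ∀ g ∈ K, t ^ i * g * (t ^ i)⁻¹ ∈ K
  anti : Antitone V
  mul_mem_V : ∀ {i j x y}, x ∈ V i → y ∈ V j → x * y ∈ V (i + j)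
  sep : ∀ x, (∀ i, x ∈ V i) → x = 0
  zpow_mem : ∀ i : ℤ, ψ (t ^ i) ∈ V i
  base : ∀ {s b x}, Cx κ ψ K s b x → x ∈ V 0
  unit : ∀ x ∈ V 1, ∃ y ∈ V 0, (1 - x) * y = 1 ∧ y * (1 - x) = 1

variable {κ : k →+* A} {ψ : G →* A} {K L : Subgroup G} {t : G}

variable (ψ t) in
/-- Evaluation of Laurent polynomials with left coefficients at `ψ t`. -/
noncomputable def ev : (ℤ →₀ A) →+ A :=
  Finsupp.liftAddHom fun i => AddMonoidHom.mulRight (ψ (t ^ i))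

@[simp] lemma ev_single (i : ℤ) (a : A) : ev ψ t (Finsupp.single i a) = a * ψ (t ^ i) := by
  simp [ev]

lemma ev_apply (c : ℤ →₀ A) : ev ψ t c = ∑ i ∈ c.support, c i * ψ (t ^ i) := by
  simp [ev, Finsupp.sum]

lemma zpow_mul_zpow (ψ : G →* A) (t : G) (i j : ℤ) :
    ψ (t ^ i) * ψ (t ^ j) = ψ (t ^ (i + j)) := by
  rw [← map_mul, zpow_add]

namespace Filt

variable (F : Filt κ ψ K t)

lemma mem_of_le {i j : ℤ} (h : i ≤ j) {x : A} (hx : x ∈ F.V j) : x ∈ F.V i := F.anti h hx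

lemma mul_mem_V' {i j m : ℤ} (h : m ≤ i + j) {x y : A} (hx : x ∈ F.V i) (hy : y ∈ F.V j) :
    x * y ∈ F.V m := F.anti h (F.mul_mem_V hx hy)

/-- Elements which are approximated by Laurent polynomials with coefficients in `S`. -/
def ES (S : Set A) (x : A) : Prop :=
  ∀ m : ℤ, ∃ c : ℤ →₀ A, (∀ i, c i ∈ S) ∧ x - ev ψ t c ∈ F.V m

variable {F}

lemma ES.mono {S T : Set A} (h : S ⊆ T) {x : A} (hx : F.ES S x) : F.ES T x := fun m =>
  let ⟨c, hc, hm⟩ := hx m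
  ⟨c, fun i => h (hc i), hm⟩

lemma ES.of_finsupp {S : Set A} {c : ℤ →₀ A} (h : ∀ i, c i ∈ S) : F.ES S (ev ψ t c) :=
  fun m => ⟨c, h, by simp⟩

lemma ES.single {S : Set A} (h0 : 0 ∈ S) {a : A} (ha : a ∈ S) (i : ℤ) :
    F.ES S (a * ψ (t ^ i)) := by
  rw [← ev_single]
  refine .of_finsupp fun j => ?_
  by_cases h : j = i
  · subst h; simpa using ha
  · simpa [Finsupp.single_eq_of_ne h] using h0

lemma ES.of_mem {S : Set A} (h0 : 0 ∈ S) {a : A} (ha : a ∈ S) : F.ES S a := by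
  simpa using ES.single (F := F) h0 ha 0

lemma ES.add {S T U : Set A} {x y : A} (hx : F.ES S x) (hy : F.ES T y)
    (h : ∀ u ∈ S, ∀ v ∈ T, u + v ∈ U) : F.ES U (x + y) := by
  intro m
  obtain ⟨c, hc, hcm⟩ := hx m
  obtain ⟨d, hd, hdm⟩ := hy m
  refine ⟨c + d, fun i => h _ (hc i) _ (hd i), ?_⟩
  rw [map_add, add_sub_add_comm]
  exact add_mem hcm hdm

lemma ES.limit {S : Set A} {x : A} (h : ∀ m : ℤ, ∃ y, F.ES S y ∧ x - y ∈ F.V m) :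
    F.ES S x := by
  intro m
  obtain ⟨y, hy, hm⟩ := h m
  obtain ⟨c, hc, hcm⟩ := hy m
  refine ⟨c, hc, ?_⟩
  have := add_mem hm hcm
  rwa [sub_add_sub_cancel] at this

lemma exists_mem_V {S : Set A} (hS : S ⊆ F.V 0) {c : ℤ →₀ A} (hc : ∀ i, c i ∈ S) :
    ∃ N, ev ψ t c ∈ F.V N := by
  obtain ⟨N, hN⟩ := c.support.finite_toSet.bddBelow
  refine ⟨N, ?_⟩
  rw [ev_apply]
  exact sum_mem fun i hi => F.mul_mem_V' (by simpa using hN hi) (hS (hc i)) (F.zpow_mem i)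

lemma ES.exists_mem_V {S : Set A} (hS : S ⊆ F.V 0) {x : A} (hx : F.ES S x) :
    ∃ N, x ∈ F.V N := by
  obtain ⟨c, hc, h0⟩ := hx 0
  obtain ⟨N, hN⟩ := Filt.exists_mem_V hS hc
  refine ⟨min N 0, ?_⟩
  have := add_mem (F.mem_of_le (min_le_right N 0) h0) (F.mem_of_le (min_le_left N 0) hN)
  rwa [sub_add_cancel] at this

lemma exists_ev_mul {S T : Set A} {U : AddSubgroup A}
    (h : ∀ u ∈ S, ∀ v ∈ T, ∀ i : ℤ, u * (ψ (t ^ i) * v * ψ (t ^ i)⁻¹) ∈ U)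
    {c d : ℤ →₀ A} (hc : ∀ i, c i ∈ S) (hd : ∀ i, d i ∈ T) :
    ∃ e : ℤ →₀ A, (∀ i, e i ∈ U) ∧ ev ψ t e = ev ψ t c * ev ψ t d := by
  let P : AddSubgroup (ℤ →₀ A) :=
    { carrier := {e | ∀ i, e i ∈ U}
      zero_mem' := fun i => U.zero_mem
      add_mem' := fun ha hb i => U.add_mem (ha i) (hb i)
      neg_mem' := fun ha i => U.neg_mem (ha i) }
  suffices H : ev ψ t c * ev ψ t d ∈ P.map (ev ψ t) by
    obtain ⟨e, he, h⟩ := H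
    exact ⟨e, he, h⟩
  rw [ev_apply, ev_apply, Finset.sum_mul_sum]
  refine sum_mem fun i _ => sum_mem fun j _ => ?_
  refine ⟨Finsupp.single (i + j) (c i * (ψ (t ^ i) * d j * ψ (t ^ i)⁻¹)), fun n => ?_, ?_⟩
  · by_cases hn : n = i + j
    · subst hn; simpa only [Finsupp.single_eq_same] using h _ (hc i) _ (hd j) i
    · simp [Finsupp.single_eq_of_ne hn]
  · rw [ev_single, ← zpow_mul_zpow]
    have := map_inv_mul_map ψ (t ^ i)
    calc _ = c i * (ψ (t ^ i) * d j * (ψ (t ^ i)⁻¹ * ψ (t ^ i)) * ψ (t ^ j)) := by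
          simp only [mul_assoc]
      _ = _ := by rw [this, mul_one]; simp only [mul_assoc]

lemma ES.mul {S T : Set A} {U : AddSubgroup A} (hS : S ⊆ F.V 0) (hT : T ⊆ F.V 0) {x y : A}
    (hx : F.ES S x) (hy : F.ES T y)
    (h : ∀ u ∈ S, ∀ v ∈ T, ∀ i : ℤ, u * (ψ (t ^ i) * v * ψ (t ^ i)⁻¹) ∈ U) :
    F.ES U (x * y) := by
  intro m
  obtain ⟨N, hN⟩ := hy.exists_mem_V hT
  obtain ⟨c, hc, hcm⟩ := hx (m - N)
  obtain ⟨N', hN'⟩ := Filt.exists_mem_V hS hc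
  obtain ⟨d, hd, hdm⟩ := hy (m - N')
  obtain ⟨e, he, hev⟩ := exists_ev_mul h hc hd
  refine ⟨e, he, ?_⟩
  have h1 := F.mul_mem_V' (m := m) (by omega) hcm hN
  have h2 := F.mul_mem_V' (m := m) (by omega) hN' hdm
  have := add_mem h1 h2
  rw [hev]
  convert this using 1
  noncomm_ring

/-- The elements approximated by Laurent polynomials over a subring form a subring. -/
def esRing (F : Filt κ ψ K t) (S : Subring A) (hS : (S : Set A) ⊆ F.V 0)
    (h : ∀ v ∈ S, ∀ i : ℤ, ψ (t ^ i) * v * ψ (t ^ i)⁻¹ ∈ S) : Subring A where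
  carrier := {x | F.ES S x}
  zero_mem' := .of_mem S.zero_mem S.zero_mem
  one_mem' := .of_mem S.zero_mem S.one_mem
  add_mem' hx hy := hx.add hy fun _ hu _ hv => add_mem hu hv
  neg_mem' {x} hx := by
    intro m
    obtain ⟨c, hc, hcm⟩ := hx m
    refine ⟨-c, fun i => neg_mem (hc i), ?_⟩
    rw [map_neg, neg_sub_neg, ← neg_sub]
    exact neg_mem hcm
  mul_mem' hx hy := ES.mul (U := S.toAddSubgroup) hS hS hx hy
    fun _ hu _ hv i => S.mul_mem hu (h _ hv i)

lemma mem_esRing {S : Subring A} {hS : (S : Set A) ⊆ F.V 0}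
    {h : ∀ v ∈ S, ∀ i : ℤ, ψ (t ^ i) * v * ψ (t ^ i)⁻¹ ∈ S} {x : A} :
    x ∈ F.esRing S hS h ↔ F.ES S x := Iff.rfl

/-- Leading term decomposition. -/
lemma ES.lead {S : Set A} (hS : ∀ u ∈ S, u = 0 ∨ ∃ v ∈ F.V 0, u * v = 1 ∧ v * u = 1)
    (hS0 : S ⊆ F.V 0) {x : A} (hx : F.ES S x) (h0 : x ≠ 0) :
    ∃ c ∈ S, ∃ d ∈ F.V 0, ∃ n : ℤ, c * d = 1 ∧ d * c = 1 ∧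
      1 - ψ (t ^ (-n)) * d * x ∈ F.V 1 := by
  obtain ⟨m, hm⟩ : ∃ m, x ∉ F.V m := by
    by_contra! h
    exact h0 (F.sep x h)
  obtain ⟨c, hc, hcm⟩ := hx m
  have hne : ∃ i ∈ c.support, i < m := by
    by_contra! h
    have : ev ψ t c ∈ F.V m := by
      rw [ev_apply]
      exact sum_mem fun i hi => F.mul_mem_V' (by simpa using h i hi) (hS0 (hc i)) (F.zpow_mem i)
    exact hm (by simpa using add_mem hcm this)
  obtain ⟨i, hi, him⟩ := hne
  have hs : c.support.Nonempty := ⟨i, hi⟩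
  set n := c.support.min' hs with hn
  have hnm : n < m := (Finset.min'_le _ _ hi).trans_lt him
  have hcn : c n ≠ 0 := Finsupp.mem_support_iff.1 (Finset.min'_mem _ hs)
  obtain ⟨d, hd, hcd, hdc⟩ := (hS _ (hc n)).resolve_left hcn
  refine ⟨c n, hc n, d, hd, n, hcd, hdc, ?_⟩
  have key : x - c n * ψ (t ^ n) ∈ F.V (n + 1) := by
    have h1 : ev ψ t c = c n * ψ (t ^ n) + ∑ i ∈ c.support.erase n, c i * ψ (t ^ i) := by
      rw [ev_apply, Finset.add_sum_erase _ (fun i => c i * ψ (t ^ i)) (Finset.min'_mem _ hs)]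
    have h2 : ∑ i ∈ c.support.erase n, c i * ψ (t ^ i) ∈ F.V (n + 1) := by
      refine sum_mem fun i hi => F.mul_mem_V' ?_ (hS0 (hc i)) (F.zpow_mem i)
      have := Finset.min'_le _ _ (Finset.mem_of_mem_erase hi)
      have := Finset.ne_of_mem_erase hi
      omega
    have := add_mem (F.mem_of_le (by omega) hcm) h2
    rw [h1] at this
    convert this using 1
    abel
  have h3 := F.mul_mem_V (F.mul_mem_V (F.zpow_mem (-n)) hd) key
  have h4 : ψ (t ^ (-n)) * d * (c n * ψ (t ^ n)) = 1 := by
    calc _ = ψ (t ^ (-n)) * (d * c n) * ψ (t ^ n) := by simp only [mul_assoc]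
      _ = 1 := by rw [hdc, mul_one, zpow_mul_zpow]; simp
  rw [mul_sub, h4] at h3
  rw [← neg_sub]
  exact neg_mem (F.mem_of_le (by omega) h3)

lemma ES.inv {S : Set A} {R : Subring A} (hR0 : (R : Set A) ⊆ F.V 0)
    (hR : ∀ v ∈ R, ∀ i : ℤ, ψ (t ^ i) * v * ψ (t ^ i)⁻¹ ∈ R) (hSR : S ⊆ R)
    (hS : ∀ u ∈ S, u = 0 ∨ ∃ v ∈ R, u * v = 1 ∧ v * u = 1)
    {x : A} (hx : F.ES S x) (h0 : x ≠ 0) :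
    ∃ y, F.ES R y ∧ x * y = 1 ∧ y * x = 1 := by
  have hS' : ∀ u ∈ S, u = 0 ∨ ∃ v ∈ F.V 0, u * v = 1 ∧ v * u = 1 := fun u hu =>
    (hS u hu).imp id fun ⟨v, hv, h⟩ => ⟨v, hR0 hv, h⟩
  obtain ⟨c, hc, d, hd, n, hcd, hdc, hw⟩ := hx.lead hS' (hSR.trans hR0) h0
  have hdR : d ∈ R := by
    rcases hS c hc with rfl | ⟨v, hv, h1, h2⟩
    · have h10 : (1 : A) = 0 := by rw [← hcd, zero_mul]
      rw [← mul_one d, h10, mul_zero]; exact R.zero_mem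
    · have : d = v := left_inv_eq_right_inv hdc h1
      rwa [this]
  let E := F.esRing R hR0 hR
  set q := 1 - ψ (t ^ (-n)) * d * x with hq
  have htE : ∀ i : ℤ, ψ (t ^ i) ∈ E := fun i => mem_esRing.2 <| by
    simpa using ES.single (F := F) (S := R) R.zero_mem R.one_mem i
  have hdE : d ∈ E := mem_esRing.2 (ES.of_mem R.zero_mem hdR)
  have hxE : x ∈ E := mem_esRing.2 (hx.mono hSR)
  have hqE : q ∈ E := sub_mem E.one_mem (mul_mem (mul_mem (htE _) hdE) hxE)
  obtain ⟨z, hz, hz1, hz2⟩ := F.unit q hw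
  have hqx : 1 - q = ψ (t ^ (-n)) * d * x := by rw [hq]; abel
  have hx' : x = c * ψ (t ^ n) * (1 - q) := by
    rw [hqx]
    calc x = c * (ψ (t ^ n) * ψ (t ^ (-n))) * d * x := by
          rw [zpow_mul_zpow]; simp [hcd]
      _ = _ := by simp only [mul_assoc]
  have hzE : z ∈ E := by
    refine mem_esRing.2 <| ES.limit fun m => ⟨∑ j ∈ Finset.range m.toNat, q ^ j,
      show _ ∈ E from sum_mem fun j _ => pow_mem hqE j, ?_⟩
    have h1 : z - ∑ j ∈ Finset.range m.toNat, q ^ j = z * q ^ m.toNat := by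
      have := mul_neg_geom_sum q m.toNat
      have h2 : z * ((1 - q) * ∑ j ∈ Finset.range m.toNat, q ^ j) = z * (1 - q ^ m.toNat) := by
        rw [this]
      rw [← mul_assoc, hz2, one_mul] at h2
      rw [h2]; noncomm_ring
    have h2 : ∀ r : ℕ, z * q ^ r ∈ F.V r := by
      intro r
      induction r with
      | zero => simpa using hz
      | succ r ih =>
        rw [pow_succ, ← mul_assoc]
        exact F.mul_mem_V' (by push_cast; omega) ih hw
    rw [h1]
    exact F.mem_of_le (by omega) (h2 _)
  refine ⟨z * (ψ (t ^ (-n)) * d), mul_mem hzE (mul_mem (htE _) hdE), ?_, ?_⟩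
  · calc _ = c * ψ (t ^ n) * ((1 - q) * z) * (ψ (t ^ (-n)) * d) := by
          conv_lhs => rw [hx']
          simp only [mul_assoc]
      _ = c * (ψ (t ^ n) * ψ (t ^ (-n))) * d := by rw [hz1]; simp only [mul_assoc, one_mul]
      _ = 1 := by rw [zpow_mul_zpow]; simp [hcd]
  · calc _ = z * (ψ (t ^ (-n)) * d * x) := by simp only [mul_assoc]
      _ = 1 := by rw [← hqx, hz2]

end Filt

end Filtration

end Cplx

namespace Cplx

section Induction

variable {k : Type*} [Field k] {G : Type*} [Group G] {A : Type*} [Ring A]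
variable {κ : k →+* A} {ψ : G →* A} {K L : Subgroup G} {t : G}

lemma map_mul_cancel (ψ : G →* A) (g : G) (x : A) : ψ g * (ψ g⁻¹ * x) = x := by
  rw [← mul_assoc, map_mul_map_inv, one_mul]

lemma map_inv_mul_cancel (ψ : G →* A) (g : G) (x : A) : ψ g⁻¹ * (ψ g * x) = x := by
  rw [← mul_assoc, map_inv_mul_map, one_mul]

lemma Filt.ES.reindex {F : Filt κ ψ K t} {S T : Set A} {f : ℤ → A → A} (hf : ∀ i, f i 0 = 0)
    {Φ : A →+ A} {d : ℤ} (h : ∀ i a, Φ (a * ψ (t ^ i)) = f i a * ψ (t ^ (i + d)))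
    (hST : ∀ i, ∀ a ∈ S, f i a ∈ T) (hV : ∀ m, ∀ x ∈ F.V m, Φ x ∈ F.V (m + d)) {x : A}
    (hx : F.ES S x) : F.ES T (Φ x) := by
  intro m
  obtain ⟨c, hc, hcm⟩ := hx (m - d)
  let c' : ℤ →₀ A := Finsupp.onFinset (c.support.map (Equiv.addRight d).toEmbedding)
    (fun j => f (j - d) (c (j - d))) (by
      intro j hj
      simp only [Finset.mem_map_equiv, Finsupp.mem_support_iff]
      intro h0
      apply hj
      have : c (j - d) = 0 := h0
      rw [this, hf])
  refine ⟨c', fun i => hST _ _ (hc _), ?_⟩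
  have : ev ψ t c' = Φ (ev ψ t c) := by
    rw [ev_apply c, map_sum]
    have h1 : ev ψ t c' = ∑ i ∈ c.support.map (Equiv.addRight d).toEmbedding,
        c' i * ψ (t ^ i) := by
      rw [ev_apply]
      refine Finset.sum_subset Finsupp.support_onFinset_subset fun i _ hi => ?_
      rw [Finsupp.notMem_support_iff.1 hi, zero_mul]
    rw [h1, Finset.sum_map]
    refine Finset.sum_congr rfl fun i _ => ?_
    rw [h]
    simp [c']
  rw [this, ← map_sub]
  simpa using hV _ _ hcm

/-- Every element of `L` is an element of `K` times a power of `t`. -/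
def Cov (K : Subgroup G) (t : G) (L : Subgroup G) : Prop :=
  ∀ g ∈ L, ∃ d : ℤ, ∃ u ∈ K, g = u * t ^ d

lemma Cov.mono {L' : Subgroup G} (h : L' ≤ L) (hL : Cov K t L) : Cov K t L' :=
  fun g hg => hL g (h hg)

lemma Filt.ES.mul_map {F : Filt κ ψ K t} {b : Cplx} {x : A}
    (hx : F.ES (sumsBelow κ ψ K b) x) {u : G} (hu : u ∈ K) (d : ℤ) :
    F.ES (sumsBelow κ ψ K b) (x * ψ (u * t ^ d)) := by
  refine Filt.ES.reindex (f := fun i a => a * ψ (t ^ i * u * (t ^ i)⁻¹))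
    (Φ := AddMonoidHom.mulRight (ψ (u * t ^ d))) (d := d) (by simp) (fun i a => ?_)
    (fun i a ha => ?_) (fun m x hx => ?_) hx
  · simp only [AddMonoidHom.mulRight_apply, mul_assoc, ← map_mul]
    congr 2
    group
  · obtain ⟨c, hc, ha⟩ := ha
    exact ⟨c, hc, ha.mul_unit (F.conj_mem i u hu)⟩
  · simp only [AddMonoidHom.mulRight_apply, map_mul]
    refine F.mul_mem_V' (i := m) (j := d) le_rfl hx ?_
    exact F.mul_mem_V' (by simp) (F.base (Cx.unit' hu)) (F.zpow_mem d)

lemma Filt.ES.map_mul {F : Filt κ ψ K t} (hκ : ∀ c g, Commute (κ c) (ψ g)) {b : Cplx} {x : A}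
    (hx : F.ES (sumsBelow κ ψ K b) x) {u : G} (hu : u ∈ K) (d : ℤ) :
    F.ES (sumsBelow κ ψ K b) (ψ (u * t ^ d) * x) := by
  refine Filt.ES.reindex (f := fun i a => ψ u * (ψ (t ^ d) * a * ψ (t ^ d)⁻¹))
    (Φ := AddMonoidHom.mulLeft (ψ (u * t ^ d))) (d := d) (by simp) (fun i a => ?_)
    (fun i a ha => ?_) (fun m x hx => ?_) hx
  · have h1 : ψ (t ^ (i + d)) = ψ (t ^ d) * ψ (t ^ i) := by rw [zpow_mul_zpow, add_comm]
    rw [h1, AddMonoidHom.coe_mulLeft, _root_.map_mul]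
    simp only [mul_assoc, map_inv_mul_cancel]
  · obtain ⟨c, hc, ha⟩ := ha
    exact ⟨c, hc, (ha.conj hκ (F.conj_mem d)).unit_mul hu⟩
  · simp only [AddMonoidHom.coe_mulLeft, _root_.map_mul]
    refine F.mul_mem_V' (i := d) (j := m) (by omega) ?_ hx
    exact F.mul_mem_V' (by simp) (F.base (Cx.unit' hu)) (F.zpow_mem d)

variable (κ ψ K) in
/-- Admissible coefficients in the expansion of an element of complexity `a`. -/
def coeffs (s : Bool) (a : Cplx) : Set A :=
  if s then (below κ ψ K a : Set A) else sumsBelow κ ψ K a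

variable (κ ψ) in
/-- An element of complexity `a` over a finitely generated `L` whose expansions have
coefficients of smaller complexity. -/
def Good (s : Bool) (L : Subgroup G) (a : Cplx) (x : A) : Prop :=
  L.FG ∧ Cx κ ψ L s a x ∧ ∀ (K : Subgroup G) (t : G) (F : Filt κ ψ K t), Cov K t L → ¬ L ≤ K →
    0 < a ∧ F.ES (coeffs κ ψ K s a) x

lemma Filt.below_subset (F : Filt κ ψ K t) (a : Cplx) : (below κ ψ K a : Set A) ⊆ F.V 0 := by
  have : below κ ψ K a ≤ F.V 0 := (AddSubgroup.closure_le _).2 fun x ⟨b, _, hx⟩ => F.base hx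
  exact this

namespace Good

lemma bot (c : k) : Good κ ψ true ⊥ 0 (κ c) :=
  ⟨Subgroup.FG.bot, by simpa using Cx.unit (κ := κ) (ψ := ψ) c 1 (one_mem (⊥ : Subgroup G)),
    fun _ _ _ _ h => (h bot_le).elim⟩

lemma mul (hκ : ∀ c g, Commute (κ c) (ψ g)) {L' : Subgroup G} {α β : Cplx} {x y : A}
    (hx : Good κ ψ true L α x) (hy : Good κ ψ true L' β y) :
    Good κ ψ true (L ⊔ L') (α + β) (x * y) := by
  obtain ⟨hxL, hxC, hx⟩ := hx
  obtain ⟨hyL, hyC, hy⟩ := hy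
  refine ⟨hxL.sup hyL, (hxC.mono le_sup_left).mul (hyC.mono le_sup_right),
    fun K t F hcov hle => ?_⟩
  have hx := hx K t F (hcov.mono le_sup_left)
  have hy := hy K t F (hcov.mono le_sup_right)
  simp only [coeffs, if_true] at hx hy ⊢
  have hat : ∀ β, {y | Cx κ ψ K true β y} ⊆ (F.V 0 : Set A) := fun β y hy => F.base hy
  by_cases h1 : L ≤ K
  · by_cases h2 : L' ≤ K
    · exact (hle (sup_le h1 h2)).elim
    · obtain ⟨hβ, hy⟩ := hy h2
      refine ⟨hβ.trans_le (le_add_of_nonneg_left (zero_le _)), ?_⟩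
      have hx' : F.ES {x | Cx κ ψ K true α x} x :=
        .of_mem (hxC.mono h1).atom_zero (hxC.mono h1)
      exact hx'.mul (hat _) (F.below_subset _) hy fun u hu v hv i =>
        atom_mul_below hu (below_conj hκ (F.conj_mem i) hv)
  · obtain ⟨hα, hx⟩ := hx h1
    refine ⟨hα.trans_le (le_add_of_nonneg_right (zero_le _)), ?_⟩
    by_cases h2 : L' ≤ K
    · have hy' : F.ES {x | Cx κ ψ K true β x} y :=
        .of_mem (hyC.mono h2).atom_zero (hyC.mono h2)
      exact hx.mul (F.below_subset _) (hat _) hy' fun u hu v hv i =>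
        below_mul_atom hu (hv.conj hκ (F.conj_mem i))
    · obtain ⟨hβ, hy⟩ := hy h2
      exact hx.mul (F.below_subset _) (F.below_subset _) hy fun u hu v hv i =>
        below_mul_below hu (below_conj hκ (F.conj_mem i) hv)

lemma atom {α : Cplx} {x : A} (hx : Good κ ψ true L α x) : Good κ ψ false L (w α) x := by
  refine ⟨hx.1, hx.2.1.atom, fun K t F hcov hle => ⟨w_pos _, ?_⟩⟩
  obtain ⟨h0, h⟩ := hx.2.2 K t F hcov hle
  simp only [coeffs, if_true] at h ⊢
  exact h.mono fun _ hu => mem_sumsBelow_of_mem_below h0 hu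

lemma add_aux {L' : Subgroup G} {α b : Cplx} {x y y' : A} {g : G}
    (hx : Good κ ψ true L α x) (hy : Good κ ψ false L' b y)
    (hC : Cx κ ψ (L ⊔ L' ⊔ Subgroup.zpowers g) false b y')
    (h1 : ∀ K t, ∀ F : Filt κ ψ K t, ∀ u ∈ K, ∀ d : ℤ, g = u * t ^ d →
      F.ES (sumsBelow κ ψ K b) y → F.ES (sumsBelow κ ψ K b) y')
    (h2 : ∀ K t, ∀ _ : Filt κ ψ K t, ∀ u ∈ K, ∀ d : ℤ, g = u * t ^ d →
      Cx κ ψ K false b y → ∃ z, Cx κ ψ K false b z ∧ y' = z * ψ (t ^ d)) :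
    Good κ ψ false (L ⊔ L' ⊔ Subgroup.zpowers g) (w α + b) (x + y') := by
  obtain ⟨hxL, hxC, hx⟩ := hx
  obtain ⟨hyL, hyC, hy⟩ := hy
  have hLL : L ≤ L ⊔ L' ⊔ Subgroup.zpowers g := le_sup_left.trans le_sup_left
  have hLL' : L' ≤ L ⊔ L' ⊔ Subgroup.zpowers g := le_sup_right.trans le_sup_left
  have hb0 : 0 < b := (w_pos 0).trans_le hyC.w_zero_le
  have hwb : w α < w α + b := lt_add_of_pos_right _ hb0
  have hbw : b < w α + b := lt_add_of_pos_left _ (w_pos α)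
  have hzg : (Subgroup.zpowers g).FG := by
    rw [Subgroup.zpowers_eq_closure]
    exact ⟨{g}, by simp⟩
  refine ⟨(hxL.sup hyL).sup hzg, (hxC.mono hLL).add hC, fun K t F hcov hle =>
    ⟨(w_pos _).trans hwb, ?_⟩⟩
  obtain ⟨d, u, hu, hg⟩ := hcov g ((le_sup_right : _ ≤ L ⊔ L' ⊔ Subgroup.zpowers g)
    (Subgroup.mem_zpowers g))
  have hx := hx K t F (hcov.mono hLL)
  have hy := hy K t F (hcov.mono hLL')
  simp only [coeffs, if_true, Bool.false_eq_true, if_false] at hx hy ⊢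
  have h1 := h1 K t F u hu d hg
  have h2 := h2 K t F u hu d hg
  by_cases hL : L ≤ K
  · have hxK := hxC.mono hL
    by_cases hL' : L' ≤ K
    · have hyK := hyC.mono hL'
      obtain ⟨z, hz, rfl⟩ := h2 hyK
      have hd : d ≠ 0 := by
        rintro rfl
        apply hle (sup_le (sup_le hL hL') _)
        rw [Subgroup.zpowers_le, hg]
        simpa using hu
      have : x + z * ψ (t ^ d) = ev ψ t (Finsupp.single 0 x + Finsupp.single d z) := by
        simp
      rw [this]
      refine .of_finsupp fun i => ?_
      by_cases hi : i = 0
      · subst hi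
        simp only [Finsupp.add_apply, Finsupp.single_eq_same, Finsupp.single_eq_of_ne hd.symm,
          add_zero]
        exact ⟨_, hwb, hxK.atom⟩
      · by_cases hid : i = d
        · subst hid
          simp only [Finsupp.add_apply, Finsupp.single_eq_same, Finsupp.single_eq_of_ne hd,
            zero_add]
          exact ⟨_, hbw, hz⟩
        · simp only [Finsupp.add_apply, Finsupp.single_eq_of_ne hi, Finsupp.single_eq_of_ne hid,
            zero_add]
          exact ⟨_, hbw, hz.sum_zero⟩
    · obtain ⟨-, hy⟩ := hy hL'
      have hx' : F.ES {x | Cx κ ψ K true α x} x := .of_mem hxK.atom_zero hxK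
      refine hx'.add (h1 hy) fun p hp q hq => ?_
      obtain ⟨c, hc, hq⟩ := hq
      exact ⟨_, add_lt_add_right hc _, Cx.add hp hq⟩
  · obtain ⟨h0, hx⟩ := hx hL
    have hx : F.ES (sumsBelow κ ψ K (w α)) x :=
      hx.mono fun _ hu => mem_sumsBelow_of_mem_below h0 hu
    by_cases hL' : L' ≤ K
    · obtain ⟨z, hz, rfl⟩ := h2 (hyC.mono hL')
      have hy' : F.ES {x | Cx κ ψ K false b x} (z * ψ (t ^ d)) := .single hz.sum_zero hz d
      refine hx.add hy' fun p hp q hq => ?_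
      obtain ⟨c, hc, hp⟩ := hp
      exact ⟨_, add_lt_add_left hc _, hp.sum_add hq⟩
    · obtain ⟨-, hy⟩ := hy hL'
      refine hx.add (h1 hy) fun p hp q hq => ?_
      obtain ⟨c, hc, hp⟩ := hp
      obtain ⟨c', hc', hq⟩ := hq
      exact ⟨_, add_lt_add hc hc', hp.sum_add hq⟩

lemma add_right {L' : Subgroup G} {α b : Cplx} {x y : A}
    (g : G) (hx : Good κ ψ true L α x) (hy : Good κ ψ false L' b y) :
    Good κ ψ false (L ⊔ L' ⊔ Subgroup.zpowers g) (w α + b) (x + y * ψ g) := by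
  refine add_aux hx hy ((hy.2.1.mono (le_sup_right.trans le_sup_left)).mul_unit
    ((le_sup_right : _ ≤ L ⊔ L' ⊔ Subgroup.zpowers g) (Subgroup.mem_zpowers g))) ?_ ?_
  · rintro K t F u hu d rfl h
    exact h.mul_map hu d
  · rintro K t F u hu d rfl h
    exact ⟨y * ψ u, h.mul_unit hu, by rw [map_mul, mul_assoc]⟩

lemma add_left (hκ : ∀ c g, Commute (κ c) (ψ g)) {L' : Subgroup G} {α b : Cplx} {x y : A}
    (g : G) (hx : Good κ ψ true L α x) (hy : Good κ ψ false L' b y) :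
    Good κ ψ false (L ⊔ L' ⊔ Subgroup.zpowers g) (w α + b) (x + ψ g * y) := by
  refine add_aux hx hy ((hy.2.1.mono (le_sup_right.trans le_sup_left)).unit_mul
    ((le_sup_right : _ ≤ L ⊔ L' ⊔ Subgroup.zpowers g) (Subgroup.mem_zpowers g))) ?_ ?_
  · rintro K t F u hu d rfl h
    exact h.map_mul hκ hu d
  · rintro K t F u hu d rfl h
    refine ⟨ψ u * (ψ (t ^ d) * y * ψ (t ^ d)⁻¹), (h.conj hκ (F.conj_mem d)).unit_mul hu, ?_⟩
    have := map_inv_mul_map ψ (t ^ d)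
    rw [map_mul]
    calc ψ u * ψ (t ^ d) * y = ψ u * (ψ (t ^ d) * y * (ψ (t ^ d)⁻¹ * ψ (t ^ d))) := by
          rw [this, mul_one, mul_assoc]
      _ = _ := by simp only [mul_assoc]

lemma exists_inv (hκ : ∀ c g, Commute (κ c) (ψ g)) {a : Cplx} {x : A}
    (IH : ∀ b < a, ∀ z, Cx κ ψ ⊤ false b z → z = 0 ∨ ∃ z', z * z' = 1 ∧ z' * z = 1)
    (hx : Good κ ψ false L a x) (h0 : x ≠ 0) (F : Filt κ ψ K t) (hcov : Cov K t L)
    (hle : ¬ L ≤ K) : ∃ y, F.ES (below κ ψ K (w a)) y ∧ x * y = 1 ∧ y * x = 1 := by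
  obtain ⟨-, hE⟩ := hx.2.2 K t F hcov hle
  simp only [coeffs, Bool.false_eq_true, if_false] at hE
  refine Filt.ES.inv (R := belowRing κ ψ K a) (F.below_subset _)
    (fun v hv i => below_conj hκ (F.conj_mem i) hv) (S := sumsBelow κ ψ K a) ?_ ?_ hE h0
  · rintro u ⟨b, hb, hu⟩
    exact mem_below_w hu hb.le
  · rintro u ⟨b, hb, hu⟩
    refine (IH b hb u (hu.mono le_top)).imp id ?_
    rintro ⟨v, h1, h2⟩
    exact ⟨v, AddSubgroup.subset_closure ⟨w b, w_strictMono hb, .inv hu h1 h2⟩, h1, h2⟩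

lemma inv [Nontrivial A] (hκ : ∀ c g, Commute (κ c) (ψ g)) {a : Cplx} {x y : A}
    (IH : ∀ b < a, ∀ z, Cx κ ψ ⊤ false b z → z = 0 ∨ ∃ z', z * z' = 1 ∧ z' * z = 1)
    (hx : Good κ ψ false L a x) (h1 : x * y = 1) (h2 : y * x = 1) :
    Good κ ψ true L (w a) y := by
  refine ⟨hx.1, hx.2.1.inv h1 h2, fun K t F hcov hle => ⟨w_pos _, ?_⟩⟩
  have h0 : x ≠ 0 := by
    rintro rfl
    simp at h1
  obtain ⟨y', hy', h1', -⟩ := hx.exists_inv hκ IH h0 F hcov hle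
  have : y = y' := left_inv_eq_right_inv h2 h1'
  subst this
  simpa only [coeffs, if_true] using hy'

end Good

variable (κ ψ) in
/-- Every one-sided translate can be completed to a translate which is good. -/
def Translatable (s : Bool) (a : Cplx) (x : A) : Prop :=
  (∀ u, ∃ v L, Good κ ψ s L a (ψ u * x * ψ v)) ∧ (∀ v, ∃ u L, Good κ ψ s L a (ψ u * x * ψ v))

lemma Cx.translatable [Nontrivial A] (hκ : ∀ c g, Commute (κ c) (ψ g)) {a : Cplx}
    (IH : ∀ b < a, ∀ z, Cx κ ψ ⊤ false b z → z = 0 ∨ ∃ z', z * z' = 1 ∧ z' * z = 1)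
    {s : Bool} {b : Cplx} {x : A} (hx : Cx κ ψ L s b x) (hb : (if s then w b else b) ≤ a) :
    Translatable κ ψ s b x := by
  induction hx with
  | unit c g hg =>
    refine ⟨fun u => ⟨(u * g)⁻¹, ⊥, ?_⟩, fun v => ⟨(g * v)⁻¹, ⊥, ?_⟩⟩
    · convert Good.bot (κ := κ) (ψ := ψ) c using 1
      rw [← mul_assoc, ← (hκ c u).eq, mul_assoc, mul_assoc, ← mul_assoc (ψ u), ← map_mul,
        map_mul_map_inv, mul_one]
    · convert Good.bot (κ := κ) (ψ := ψ) c using 1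
      rw [← mul_assoc, ← (hκ c _).eq, mul_assoc, mul_assoc, ← map_mul ψ g, map_inv_mul_map,
        mul_one]
  | @mul α β x y _ _ ihx ihy =>
    simp only [if_true] at hb ihx ihy
    have hx := ihx ((w_strictMono.monotone (le_add_of_nonneg_right (zero_le _))).trans hb)
    have hy := ihy ((w_strictMono.monotone (le_add_of_nonneg_left (zero_le _))).trans hb)
    constructor
    · intro u
      obtain ⟨v₁, L₁, h₁⟩ := hx.1 u
      obtain ⟨v₂, L₂, h₂⟩ := hy.1 v₁⁻¹
      refine ⟨v₂, L₁ ⊔ L₂, ?_⟩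
      convert h₁.mul hκ h₂ using 1
      simp only [mul_assoc, map_mul_cancel]
    · intro v
      obtain ⟨u₂, L₂, h₂⟩ := hy.2 v
      obtain ⟨u₁, L₁, h₁⟩ := hx.2 u₂⁻¹
      refine ⟨u₁, L₁ ⊔ L₂, ?_⟩
      convert h₁.mul hκ h₂ using 1
      simp only [mul_assoc, map_inv_mul_cancel]
  | @inv c x y _ h1 h2 ih =>
    simp only [if_true, Bool.false_eq_true, if_false] at hb ih
    have hca : c ≤ a := (lt_w c).le.trans ((lt_w _).le.trans hb)
    have hx := ih hca
    constructor
    · intro u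
      obtain ⟨u', L', h⟩ := hx.2 u⁻¹
      refine ⟨u'⁻¹, L', h.inv hκ (fun b hb => IH b (hb.trans_le hca)) ?_ ?_⟩
      · simp only [mul_assoc, map_inv_mul_cancel]
        rw [← mul_assoc x, h1, one_mul, map_mul_map_inv]
      · simp only [mul_assoc, map_inv_mul_cancel]
        rw [← mul_assoc y, h2, one_mul, map_mul_map_inv]
    · intro v
      obtain ⟨v', L', h⟩ := hx.1 v⁻¹
      refine ⟨v'⁻¹, L', h.inv hκ (fun b hb => IH b (hb.trans_le hca)) ?_ ?_⟩
      · simp only [mul_assoc, map_mul_cancel]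
        rw [← mul_assoc x, h1, one_mul, map_inv_mul_map]
      · simp only [mul_assoc, map_mul_cancel]
        rw [← mul_assoc y, h2, one_mul, map_inv_mul_map]
  | atom _ ih =>
    simp only [if_true, Bool.false_eq_true, if_false] at hb ih
    have hx := ih hb
    exact ⟨fun u => let ⟨v, L, h⟩ := hx.1 u; ⟨v, L, h.atom⟩,
      fun v => let ⟨u, L, h⟩ := hx.2 v; ⟨u, L, h.atom⟩⟩
  | @add α b x y _ _ ihx ihy =>
    simp only [if_true, Bool.false_eq_true, if_false] at hb ihx ihy
    have hx := ihx ((le_add_of_nonneg_right (zero_le _)).trans hb)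
    have hy := ihy ((le_add_of_nonneg_left (zero_le _)).trans hb)
    constructor
    · intro u
      obtain ⟨v₁, L₁, h₁⟩ := hx.1 u
      obtain ⟨v₂, L₂, h₂⟩ := hy.1 u
      refine ⟨v₁, L₁ ⊔ L₂ ⊔ Subgroup.zpowers (v₂⁻¹ * v₁), ?_⟩
      convert h₁.add_right (v₂⁻¹ * v₁) h₂ using 1
      simp only [mul_assoc, map_mul, map_mul_cancel, mul_add, add_mul]
    · intro v
      obtain ⟨u₁, L₁, h₁⟩ := hx.2 v
      obtain ⟨u₂, L₂, h₂⟩ := hy.2 v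
      refine ⟨u₁, L₁ ⊔ L₂ ⊔ Subgroup.zpowers (u₁ * u₂⁻¹), ?_⟩
      convert h₁.add_left hκ (u₁ * u₂⁻¹) h₂ using 1
      simp only [mul_assoc, map_mul, map_inv_mul_cancel, mul_add, add_mul]

lemma Cx.mem_range_of_bot [Nontrivial A] {s : Bool} {b : Cplx} {x : A} (hx : Cx κ ψ ⊥ s b x) :
    ∃ c, x = κ c := by
  induction hx with
  | unit c g hg =>
    rw [Subgroup.mem_bot] at hg
    subst hg
    exact ⟨c, by simp⟩
  | mul _ _ h1 h2 =>
    obtain ⟨c, rfl⟩ := h1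
    obtain ⟨d, rfl⟩ := h2
    exact ⟨c * d, by simp⟩
  | inv _ h1 h2 h3 =>
    obtain ⟨c, rfl⟩ := h3
    have hc : c ≠ 0 := by
      rintro rfl
      simp at h1
    refine ⟨c⁻¹, left_inv_eq_right_inv h2 ?_⟩
    rw [← map_mul, mul_inv_cancel₀ hc, map_one]
  | atom _ h1 => exact h1
  | add _ _ h1 h2 =>
    obtain ⟨c, rfl⟩ := h1
    obtain ⟨d, rfl⟩ := h2
    exact ⟨c + d, by simp⟩

/-- If enough filtrations exist, then the rational closure is a division ring. -/
theorem Cx.eq_zero_or_isUnit [Nontrivial A] (hκ : ∀ c g, Commute (κ c) (ψ g))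
    (hF : ∀ L : Subgroup G, L.FG → L ≠ ⊥ →
      ∃ K t, Nonempty (Filt κ ψ K t) ∧ Cov K t L ∧ ¬ L ≤ K) (a : Cplx) :
    ∀ x, Cx κ ψ ⊤ false a x → x = 0 ∨ ∃ y, x * y = 1 ∧ y * x = 1 := by
  induction a using WellFoundedLT.induction with
  | ind a IH =>
  intro x hx
  obtain ⟨v, L, h⟩ := (hx.translatable hκ IH (by simp)).1 1
  simp only [map_one, one_mul] at h
  suffices H : x * ψ v = 0 ∨ ∃ y, x * ψ v * y = 1 ∧ y * (x * ψ v) = 1 by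
    refine H.imp (fun h0 => ?_) ?_
    · have : x * ψ v * ψ v⁻¹ = x := by rw [mul_assoc, map_mul_map_inv, mul_one]
      rw [← this, h0, zero_mul]
    · rintro ⟨y, h1, h2⟩
      refine ⟨ψ v * y, by rw [← mul_assoc, h1], ?_⟩
      have : ψ v * (y * (x * ψ v)) * ψ v⁻¹ = 1 := by rw [h2, mul_one, map_mul_map_inv]
      rw [← this]
      simp only [mul_assoc, map_mul_map_inv, mul_one]
  by_cases h0 : x * ψ v = 0
  · exact .inl h0
  right
  by_cases hL : L = ⊥
  · subst hL
    obtain ⟨c, hc⟩ := h.2.1.mem_range_of_bot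
    rw [hc] at h0 ⊢
    have hc0 : c ≠ 0 := by rintro rfl; simp at h0
    refine ⟨κ c⁻¹, ?_, ?_⟩
    · rw [← map_mul, mul_inv_cancel₀ hc0, map_one]
    · rw [← map_mul, inv_mul_cancel₀ hc0, map_one]
  · obtain ⟨K, t, ⟨F⟩, hcov, hle⟩ := hF L h.1 hL
    obtain ⟨y, -, hy⟩ := h.exists_inv hκ IH h0 F hcov hle
    exact ⟨y, hy⟩

end Induction

end Cplx

namespace TwistedLaurent

variable {D : Type*} [DivisionRing D]

/-- The data making the left span of the powers of `t` over `B` a ring of twisted Laurent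
polynomials. -/
structure IsTwisted (B : Subfield D) (t : D) : Prop where
  ne_zero : t ≠ 0
  conj_mem : ∀ b ∈ B, ∀ i : ℤ, t ^ i * b * (t ^ i)⁻¹ ∈ B
  li : LinearIndependent B (fun i : ℤ => t ^ i)

variable (B : Subfield D) (t : D)

/-- Laurent polynomials with exponents in `s`. -/
def Sp (s : Set ℤ) : Submodule B D := Submodule.span B ((fun i : ℤ => t ^ i) '' s)

/-- Laurent polynomials of order at least `m`. -/
abbrev P (m : ℤ) : Submodule B D := Sp B t (Set.Ici m)

variable {B t}

lemma Sp_mono {s s' : Set ℤ} (h : s ⊆ s') : Sp B t s ≤ Sp B t s' :=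
  Submodule.span_mono (Set.image_mono h)

lemma zpow_mem_Sp {s : Set ℤ} {i : ℤ} (h : i ∈ s) : t ^ i ∈ Sp B t s :=
  Submodule.subset_span ⟨i, h, rfl⟩

lemma mul_mem_Sp {s : Set ℤ} {b x : D} (hb : b ∈ B) (hx : x ∈ Sp B t s) : b * x ∈ Sp B t s :=
  (Sp B t s).smul_mem (⟨b, hb⟩ : B) hx

namespace IsTwisted

variable (h : IsTwisted B t)
include h

lemma Sp_mul_Sp {s s' u : Set ℤ} (hs : ∀ a ∈ s, ∀ b ∈ s', a + b ∈ u) {x y : D}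
    (hx : x ∈ Sp B t s) (hy : y ∈ Sp B t s') : x * y ∈ Sp B t u := by
  induction hx using Submodule.span_induction with
  | zero => simp
  | add x x' _ _ h1 h2 => rw [add_mul]; exact add_mem h1 h2
  | smul b x _ h1 =>
    have : b • x * y = b.1 * (x * y) := mul_assoc _ _ _
    rw [this]; exact mul_mem_Sp b.2 h1
  | mem x hx =>
    obtain ⟨i, hi, rfl⟩ := hx
    induction hy using Submodule.span_induction with
    | zero => simp
    | add x x' _ _ h1 h2 => rw [mul_add]; exact add_mem h1 h2
    | smul b x _ h1 =>
      have : t ^ i * (b • x) = t ^ i * b.1 * (t ^ i)⁻¹ * (t ^ i * x) := by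
        rw [show b • x = b.1 * x from rfl]
        rw [← mul_assoc (_ * _ * _), inv_mul_cancel_right₀ (zpow_ne_zero _ h.ne_zero), mul_assoc]
      simp only at h1 ⊢
      rw [this]; exact mul_mem_Sp (h.conj_mem _ b.2 i) h1
    | mem y hy =>
      obtain ⟨j, hj, rfl⟩ := hy
      simp only
      rw [← zpow_add₀ h.ne_zero]
      exact zpow_mem_Sp (hs i hi j hj)

lemma P_mul_P {i j m : ℤ} (hm : m ≤ i + j) {x y : D} (hx : x ∈ P B t i) (hy : y ∈ P B t j) :
    x * y ∈ P B t m :=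
  h.Sp_mul_Sp (fun a ha b hb => by simp only [Set.mem_Ici] at *; omega) hx hy

omit h in
lemma P_anti {i j : ℤ} (hij : i ≤ j) : P B t j ≤ P B t i := Sp_mono (Set.Ici_subset_Ici.2 hij)

omit h in
lemma exists_lead {i : ℤ} {x : D} (hx : x ∈ P B t i) :
    ∃ b ∈ B, ∃ y ∈ P B t (i + 1), x = b * t ^ i + y := by
  have : (fun i : ℤ => t ^ i) '' Set.Ici i =
      insert (t ^ i) ((fun i : ℤ => t ^ i) '' Set.Ici (i + 1)) := by
    rw [← Set.image_insert_eq (f := fun i : ℤ => t ^ i)]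
    congr 1
    ext j
    simp only [Set.mem_Ici, Set.mem_insert_iff]
    omega
  unfold P Sp at hx
  rw [this, Submodule.mem_span_insert] at hx
  obtain ⟨a, z, hz, rfl⟩ := hx
  exact ⟨a, a.2, z, hz, rfl⟩

lemma lead_notMem {i : ℤ} {b : D} (hb : b ∈ B) (hb0 : b ≠ 0) : b * t ^ i ∉ P B t (i + 1) := by
  intro hc
  have := mul_mem_Sp (B.inv_mem hb) hc
  rw [inv_mul_cancel_left₀ hb0] at this
  exact h.li.notMem_span_image (by simp) this

lemma mul_notMem {i j : ℤ} {x y : D} (hx : x ∈ P B t i) (hx' : x ∉ P B t (i + 1))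
    (hy : y ∈ P B t j) (hy' : y ∉ P B t (j + 1)) : x * y ∉ P B t (i + j + 1) := by
  obtain ⟨b, hb, x', hx1, rfl⟩ := exists_lead hx
  obtain ⟨c, hc, y', hy1, rfl⟩ := exists_lead hy
  have hb0 : b ≠ 0 := by rintro rfl; exact hx' (by simpa using hx1)
  have hc0 : c ≠ 0 := by rintro rfl; exact hy' (by simpa using hy1)
  have ht : t ^ i ≠ 0 := zpow_ne_zero _ h.ne_zero
  intro hcon
  have h1 : b * t ^ i ∈ P B t i := mul_mem_Sp hb (zpow_mem_Sp (by simp))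
  have h3 := h.P_mul_P (m := i + j + 1) (by omega) h1 hy1
  have h4 := h.P_mul_P (m := i + j + 1) (by omega) hx1 hy
  have key : b * t ^ i * (c * t ^ j) ∈ P B t (i + j + 1) := by
    have := sub_mem (sub_mem hcon h4) h3
    convert this using 1
    noncomm_ring
  have : b * t ^ i * (c * t ^ j) = b * (t ^ i * c * (t ^ i)⁻¹) * t ^ (i + j) := by
    rw [zpow_add₀ h.ne_zero]
    simp only [mul_assoc, inv_mul_cancel_left₀ ht]
  rw [this] at key
  refine h.lead_notMem (mul_mem hb (h.conj_mem c hc i)) ?_ key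
  have := inv_ne_zero ht
  positivity

omit h in
lemma exists_bound {m : ℤ} {x : D} (hx : x ∈ P B t m) :
    ∃ N : ℕ, x ∈ Sp B t (Set.Ico (-N : ℤ) N) := by
  obtain ⟨l, -, rfl⟩ := (Finsupp.mem_span_image_iff_linearCombination _).1 hx
  obtain ⟨N, hN⟩ := (l.support.image Int.natAbs).bddAbove
  refine ⟨N + 1, (Finsupp.mem_span_image_iff_linearCombination _).2 ⟨l, ?_, rfl⟩⟩
  rw [Finsupp.mem_supported]
  intro i hi
  have := hN (Finset.mem_coe.2 (Finset.mem_image_of_mem Int.natAbs hi))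
  simp only [Set.mem_Ico]
  omega

lemma exists_order {m : ℤ} {x : D} (hx : x ∈ P B t m) (h0 : x ≠ 0) :
    ∃ i, m ≤ i ∧ x ∈ P B t i ∧ x ∉ P B t (i + 1) := by
  obtain ⟨N, hN⟩ := exists_bound hx
  have hNP : x ∉ P B t N := by
    intro hxN
    have hd : Disjoint (Set.Ico (-N : ℤ) N) (Set.Ici (N : ℤ)) := by
      rw [Set.disjoint_left]
      intro a ha ha'
      simp only [Set.mem_Ico, Set.mem_Ici] at *
      omega
    exact h0 ((Submodule.disjoint_def.1 (h.li.disjoint_span_image hd)) x hN hxN)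
  by_contra! hcon
  have : ∀ r : ℕ, x ∈ P B t (m + r) := by
    intro r
    induction r with
    | zero => simpa using hx
    | succ r ih =>
      have := hcon _ (by omega) ih
      push_cast
      rwa [← add_assoc]
  exact hNP (P_anti (by omega) (this (N - m).toNat))

lemma exists_common {m : ℤ} {p q : D} (hp : p ∈ P B t m) (hq : q ∈ P B t m) :
    ∃ u ∈ P B t 0, ∃ w ∈ P B t 0, (u ≠ 0 ∨ w ≠ 0) ∧ u * p = w * q := by
  obtain ⟨N₁, h1⟩ := exists_bound hp
  obtain ⟨N₂, h2⟩ := exists_bound hq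
  set N := max N₁ N₂
  have hp : p ∈ Sp B t (Set.Ico (-N : ℤ) N) := Sp_mono (Set.Ico_subset_Ico (by omega) (by omega)) h1
  have hq : q ∈ Sp B t (Set.Ico (-N : ℤ) N) := Sp_mono (Set.Ico_subset_Ico (by omega) (by omega)) h2
  set r := 2 * N + 1
  let v : Fin r ⊕ Fin r → D :=
    Sum.elim (fun i => t ^ (i : ℤ) * p) (fun i => t ^ (i : ℤ) * q)
  have hv : ¬ LinearIndependent B v := by
    classical
    intro hli
    have hfin : (Set.Ico (-N : ℤ) (N + r)).Finite := Set.finite_Ico _ _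
    let W : Finset D := (Finset.Ico (-N : ℤ) (N + r)).image (fun i : ℤ => t ^ i)
    have := linearIndependent_le_span' v hli (W : Set D) (by
      have hW : Submodule.span B (W : Set D) = Sp B t (Set.Ico (-N : ℤ) (N + r)) := by
        simp [W, Sp]
      rw [hW]
      rintro _ ⟨i | i, rfl⟩
      · exact h.Sp_mul_Sp (s := {(i : ℤ)}) (fun a ha b hb => by
          simp only [Set.mem_singleton_iff, Set.mem_Ico] at *; omega) (zpow_mem_Sp rfl) hp
      · exact h.Sp_mul_Sp (s := {(i : ℤ)}) (fun a ha b hb => by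
          simp only [Set.mem_singleton_iff, Set.mem_Ico] at *; omega) (zpow_mem_Sp rfl) hq)
    have hc : W.card ≤ 2 * N + r := by
      refine Finset.card_image_le.trans ?_
      rw [Int.card_Ico]; omega
    simp at this
    norm_cast at this
    omega
  rw [Fintype.not_linearIndependent_iff] at hv
  obtain ⟨g, hg, i, hi⟩ := hv
  have hmem : ∀ f : Fin r → B, ∑ n, f n • t ^ ((n : ℕ) : ℤ) ∈ P B t 0 := fun f =>
    sum_mem fun n _ => Submodule.smul_mem _ _ (zpow_mem_Sp (by simp))
  have hne : ∀ f : Fin r → B, ∑ n, f n • t ^ ((n : ℕ) : ℤ) = 0 → ∀ n, f n = 0 := by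
    have := h.li.comp (fun n : Fin r => ((n : ℕ) : ℤ)) (fun a b hab => by
      simpa [Fin.ext_iff] using hab)
    rw [Fintype.linearIndependent_iff] at this
    exact this
  refine ⟨_, hmem (fun n => g (.inl n)), -_, neg_mem (hmem (fun n => g (.inr n))), ?_, ?_⟩
  · by_contra! hcon
    rcases i with i | i
    · exact hi (hne _ hcon.1 i)
    · exact hi (hne _ (neg_eq_zero.1 hcon.2) i)
  · rw [Fintype.sum_sum_type] at hg
    have e1 : ∀ (f : Fin r → B) (p : D), (∑ n, f n • t ^ ((n : ℕ) : ℤ)) * p =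
        ∑ n, f n • (t ^ ((n : ℕ) : ℤ) * p) := fun f p => by
      rw [Finset.sum_mul]
      exact Finset.sum_congr rfl fun n _ => mul_assoc _ _ _
    rw [neg_mul, e1, e1]
    exact eq_neg_of_add_eq_zero_left hg

/-- The Ore condition, with control on orders. -/
lemma ore {i : ℤ} {p q : D} (hp : p ∈ P B t i) (hq : q ∈ P B t 0) (hq' : q ∉ P B t 1) :
    ∃ u ∈ P B t 0, u ∉ P B t 1 ∧ ∃ w ∈ P B t i, u * p = w * q := by
  have hq0 : q ≠ 0 := by rintro rfl; simp at hq'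
  obtain ⟨u, hu, w, hw, h0, huw⟩ := h.exists_common (P_anti (min_le_left i 0) hp)
    (P_anti (min_le_right i 0) hq)
  have hu0 : u ≠ 0 := by
    rintro rfl
    rw [zero_mul, eq_comm, mul_eq_zero] at huw
    exact h0.elim (fun h => h rfl) fun h => h (huw.resolve_right hq0)
  obtain ⟨j, -, huj, huj'⟩ := h.exists_order hu hu0
  have ht : t ^ (-j) ≠ 0 := zpow_ne_zero _ h.ne_zero
  have htP : t ^ (-j) ∈ P B t (-j) := zpow_mem_Sp (by simp)
  have hU : t ^ (-j) * u ∈ P B t 0 := h.P_mul_P (by omega) htP huj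
  have hU' : t ^ (-j) * u ∉ P B t 1 := by
    have := h.mul_notMem htP (by
      simpa using h.lead_notMem (i := -j) B.one_mem one_ne_zero) huj huj'
    simpa using this
  have hUW : t ^ (-j) * u * p = t ^ (-j) * w * q := by rw [mul_assoc, huw, mul_assoc]
  refine ⟨_, hU, hU', t ^ (-j) * w, ?_, hUW⟩
  by_contra hcon
  have hW0 : t ^ (-j) * w ≠ 0 := by
    intro h0
    rw [h0] at hcon
    exact hcon (zero_mem _)
  have hW : t ^ (-j) * w ∈ P B t (-j) := h.P_mul_P (by omega) htP hw
  obtain ⟨l, -, hl, hl'⟩ := h.exists_order hW hW0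
  have hli : l < i := by
    by_contra hge
    exact hcon (P_anti (by omega) hl)
  have := h.mul_notMem hl hl' hq (by simpa using hq')
  rw [← hUW] at this
  exact this (P_anti (by omega) (h.P_mul_P (m := i) (by omega) hU hp))

/-- Left fractions of order at least `m`. -/
def val (m : ℤ) : AddSubgroup D where
  carrier := {x | ∃ q ∈ P B t 0, q ∉ P B t 1 ∧ q * x ∈ P B t m}
  zero_mem' := ⟨1, by simpa using zpow_mem_Sp (B := B) (t := t) (s := Set.Ici 0) (i := 0) (by simp),
    by simpa using h.lead_notMem (i := 0) B.one_mem one_ne_zero, by simp⟩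
  add_mem' := by
    rintro x y ⟨q₁, h1, h1', hx⟩ ⟨q₂, h2, h2', hy⟩
    obtain ⟨u, hu, hu', w, hw, e⟩ := h.ore h1 h2 h2'
    refine ⟨u * q₁, h.P_mul_P (by omega) hu h1, ?_, ?_⟩
    · simpa using h.mul_notMem hu (by simpa using hu') h1 (by simpa using h1')
    · rw [mul_add]
      refine add_mem ?_ ?_
      · rw [mul_assoc]; exact h.P_mul_P (by omega) hu hx
      · rw [e, mul_assoc]; exact h.P_mul_P (by omega) hw hy
  neg_mem' := by
    rintro x ⟨q₁, h1, h1', hx⟩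
    exact ⟨q₁, h1, h1', by rw [mul_neg]; exact neg_mem hx⟩

omit h in
lemma one_mem_P : (1 : D) ∈ P B t 0 := by
  simpa using zpow_mem_Sp (B := B) (t := t) (s := Set.Ici 0) (i := 0) (by simp)

lemma one_notMem_P : (1 : D) ∉ P B t 1 := by
  simpa using h.lead_notMem (i := 0) B.one_mem one_ne_zero

lemma P_le_val {m : ℤ} {x : D} (hx : x ∈ P B t m) : x ∈ h.val m :=
  ⟨1, one_mem_P, h.one_notMem_P, by simpa using hx⟩

lemma zpow_mem_val (i : ℤ) : t ^ i ∈ h.val i := h.P_le_val (zpow_mem_Sp (by simp))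

lemma mem_val_zero {b : D} (hb : b ∈ B) : b ∈ h.val 0 := by
  apply h.P_le_val
  simpa using mul_mem_Sp hb one_mem_P

lemma val_anti : Antitone h.val := by
  rintro i j hij x ⟨q, h1, h2, h3⟩
  exact ⟨q, h1, h2, P_anti hij h3⟩

lemma val_mul {i j : ℤ} {x y : D} (hx : x ∈ h.val i) (hy : y ∈ h.val j) :
    x * y ∈ h.val (i + j) := by
  obtain ⟨q₁, h1, h1', hx⟩ := hx
  obtain ⟨q₂, h2, h2', hy⟩ := hy
  obtain ⟨u, hu, hu', w, hw, e⟩ := h.ore hx h2 h2'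
  refine ⟨u * q₁, h.P_mul_P (by omega) hu h1, ?_, ?_⟩
  · simpa using h.mul_notMem hu (by simpa using hu') h1 (by simpa using h1')
  · have : u * q₁ * (x * y) = w * (q₂ * y) := by
      rw [← mul_assoc w, ← e]; simp only [mul_assoc]
    rw [this]
    exact h.P_mul_P le_rfl hw hy

lemma val_sep {x : D} (hx : ∀ m, x ∈ h.val m) : x = 0 := by
  by_contra h0
  obtain ⟨q, h1, h1', hq⟩ := hx 0
  have hq0 : q ≠ 0 := by rintro rfl; simp at h1'
  obtain ⟨j, -, hj, hj'⟩ := h.exists_order hq (mul_ne_zero hq0 h0)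
  obtain ⟨q₂, h2, h2', hq₂⟩ := hx (j + 1)
  obtain ⟨u, hu, hu', w, hw, e⟩ := h.ore h1 h2 h2'
  have := h.mul_notMem hu (by simpa using hu') hj hj'
  rw [← mul_assoc, e, mul_assoc] at this
  exact this (h.P_mul_P (by omega) hw hq₂)

lemma exists_inv_mem_val {m : ℤ} {x : D} (hx : x ∈ h.val m) : ∃ j, x⁻¹ ∈ h.val j := by
  by_cases h0 : x = 0
  · exact ⟨0, by simp [h0]⟩
  obtain ⟨q, h1, h1', hq⟩ := hx
  have hq0 : q ≠ 0 := by rintro rfl; simp at h1'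
  obtain ⟨j, -, hj, hj'⟩ := h.exists_order hq (mul_ne_zero hq0 h0)
  have htP : t ^ (-j) ∈ P B t (-j) := zpow_mem_Sp (by simp)
  have htP' : t ^ (-j) ∉ P B t (-j + 1) := by
    simpa using h.lead_notMem (i := -j) B.one_mem one_ne_zero
  refine ⟨-j, t ^ (-j) * (q * x), h.P_mul_P (by omega) htP hj, ?_, ?_⟩
  · simpa using h.mul_notMem htP htP' hj hj'
  · have : t ^ (-j) * (q * x) * x⁻¹ = t ^ (-j) * q := by
      rw [mul_assoc, mul_inv_cancel_right₀ h0]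
    rw [this]
    exact h.P_mul_P (by omega) htP h1

/-- The division subring of fractions of Laurent polynomials. -/
def fractions : Subfield D where
  carrier := {x | ∃ m, x ∈ h.val m}
  zero_mem' := ⟨0, zero_mem _⟩
  one_mem' := ⟨0, h.mem_val_zero B.one_mem⟩
  add_mem' := by
    rintro x y ⟨i, hi⟩ ⟨j, hj⟩
    exact ⟨min i j, add_mem (h.val_anti (min_le_left _ _) hi) (h.val_anti (min_le_right _ _) hj)⟩
  neg_mem' := by
    rintro x ⟨i, hi⟩
    exact ⟨i, neg_mem hi⟩
  mul_mem' := by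
    rintro x y ⟨i, hi⟩ ⟨j, hj⟩
    exact ⟨_, h.val_mul hi hj⟩
  inv_mem' := by
    rintro x ⟨i, hi⟩
    exact h.exists_inv_mem_val hi

end IsTwisted

end TwistedLaurent

lemma mem_divisionClosure_iff {D : Type*} [DivisionRing D] {s : Set D} {x : D} :
    x ∈ divisionClosure s ↔ x ∈ Subfield.closure s := by
  constructor
  · intro hx
    refine Subring.mem_sInf.1 hx (Subfield.closure s).toSubring ⟨fun y hy h0 => ?_, ?_⟩
    · exact ⟨y⁻¹, (Subfield.closure s).inv_mem hy, mul_inv_cancel₀ h0, inv_mul_cancel₀ h0⟩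
    · exact Subfield.subset_closure
  · intro hx
    refine Subring.mem_sInf.2 fun S hS => ?_
    let T : Subfield D :=
      { S with
        inv_mem' := fun y hy => by
          by_cases h0 : y = 0
          · subst h0; rw [inv_zero]; exact zero_mem S
          obtain ⟨z, hz, h1, -⟩ := hS.1 y hy h0
          rwa [inv_eq_of_mul_eq_one_right h1] }
    exact (Subfield.closure_le.2 (show s ⊆ (T : Set D) from hS.2)) hx

lemma ringZPow_eq_zpow {D : Type*} [DivisionRing D] (x : D) (i : ℤ) : ringZPow x i = x ^ i := by
  unfold ringZPow
  split_ifs with h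
  · rw [← zpow_natCast, Int.toNat_of_nonneg h]
  · rw [Ring.inverse_eq_inv, inv_pow, ← zpow_natCast, Int.toNat_of_nonneg (by omega), zpow_neg,
      inv_inv]

namespace MonoidAlgebra

variable {k : Type*} [Field k] {G : Type*} [Group G] {D : Type*} [DivisionRing D]

/-- The division subring of `D` generated by the image of `k[L]`. -/
def divClosure (φ : MonoidAlgebra k G →+* D) (L : Subgroup G) : Subfield D :=
  Subfield.closure {x | ∃ g ∈ L, ∃ c, φ (single g c) = x}

variable {φ : MonoidAlgebra k G →+* D} {L : Subgroup G}

lemma apply_single_mem_divClosure {g : G} (hg : g ∈ L) (c : k) :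
    φ (single g c) ∈ divClosure φ L := Subfield.subset_closure ⟨g, hg, c, rfl⟩

lemma mem_divisionClosure_range_iff {M : Type*} [Group M] (ι : M →* G) (h : ι.range = L) {x : D} :
    x ∈ divisionClosure (Set.range (φ.comp (mapDomainRingHom k ι))) ↔ x ∈ divClosure φ L := by
  rw [mem_divisionClosure_iff]
  refine ⟨fun hx => ?_, fun hx => ?_⟩
  · refine Subfield.closure_le.2 ?_ hx
    rintro _ ⟨y, rfl⟩
    induction y using MonoidAlgebra.induction_linear with
    | zero => simp
    | add x y hx hy => rw [map_add]; exact add_mem hx hy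
    | single m c =>
      have : mapDomainRingHom k ι (single m c) = single (ι m) c := by simp
      rw [RingHom.comp_apply, this]
      exact apply_single_mem_divClosure (h ▸ ⟨m, rfl⟩) c
  · refine Subfield.closure_mono ?_ hx
    rintro _ ⟨g, hg, c, rfl⟩
    rw [← h] at hg
    obtain ⟨m, rfl⟩ := hg
    exact ⟨single m c, by simp⟩

lemma apply_of_ne_zero (φ : MonoidAlgebra k G →+* D) (g : G) : φ (of k G g) ≠ 0 := by
  intro h
  have : φ (of k G (g * g⁻¹)) = 0 := by rw [map_mul, map_mul, h, zero_mul]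
  rw [mul_inv_cancel, map_one, map_one] at this
  exact one_ne_zero this

lemma apply_of_inv (φ : MonoidAlgebra k G →+* D) (g : G) : φ (of k G g⁻¹) = (φ (of k G g))⁻¹ := by
  refine eq_inv_of_mul_eq_one_left ?_
  rw [← map_mul, ← map_mul, inv_mul_cancel, map_one, map_one]

lemma apply_of_zpow (φ : MonoidAlgebra k G →+* D) (g : G) (i : ℤ) :
    φ (of k G (g ^ i)) = φ (of k G g) ^ i :=
  map_zpow' ((φ : MonoidAlgebra k G →* D).comp (of k G)) (apply_of_inv φ) g i

lemma conj_mem_divClosure {t : G} (ht : ∀ g ∈ L, t * g * t⁻¹ ∈ L) {b : D}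
    (hb : b ∈ divClosure φ L) : φ (of k G t) * b * (φ (of k G t))⁻¹ ∈ divClosure φ L := by
  have h0 := apply_of_ne_zero φ t
  induction hb using Subfield.closure_induction with
  | mem x hx =>
    obtain ⟨g, hg, c, rfl⟩ := hx
    rw [← apply_of_inv, ← map_mul, ← map_mul, of_apply, of_apply, single_mul_single,
      single_mul_single]
    exact apply_single_mem_divClosure (ht g hg) _
  | one => rw [mul_one, mul_inv_cancel₀ h0]; exact one_mem (divClosure φ L)
  | add x y _ _ hx hy => rw [mul_add, add_mul]; exact add_mem hx hy
  | neg x _ hx => rw [mul_neg, neg_mul]; exact neg_mem hx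
  | inv x _ hx =>
    have := (divClosure φ L).inv_mem hx
    rwa [mul_inv_rev, mul_inv_rev, inv_inv, ← mul_assoc] at this
  | mul x y _ _ hx hy =>
    have := mul_mem hx hy
    convert this using 1
    simp only [mul_assoc, inv_mul_cancel_left₀ h0]

section Units

variable {Q : Type*} [Group Q]

lemma exists_inverse_of_finite {S : Type*} [DivisionRing S] [Finite Q] (x : MonoidAlgebra S Q)
    (hx : ∀ y, y * x = 0 → y = 0) : ∃ y, y * x = 1 ∧ x * y = 1 := by
  let f : MonoidAlgebra S Q →ₗ[S] MonoidAlgebra S Q :=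
    { toFun := fun y => y * x
      map_add' := fun a b => add_mul a b x
      map_smul' := fun c a => smul_mul_assoc c a x }
  have hf : Function.Injective f := by
    rw [injective_iff_map_eq_zero]
    exact hx
  obtain ⟨y, hy⟩ := LinearMap.injective_iff_surjective.1 hf 1
  have hy : y * x = 1 := hy
  refine ⟨y, hy, ?_⟩
  rw [← sub_eq_zero]
  apply hx
  rw [sub_mul, mul_assoc, hy, mul_one, one_mul, sub_self]

/-- The elements with coefficients in `S`. -/
noncomputable def coeffsIn (S : Subfield D) : Subring (MonoidAlgebra D Q) :=
  (mapRingHom Q S.subtype).range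

lemma mem_coeffsIn {S : Subfield D} {x : MonoidAlgebra D Q} :
    x ∈ coeffsIn S ↔ ∀ q, x.coeff q ∈ S := by
  constructor
  · rintro ⟨y, rfl⟩ q
    rw [coeff_mapRingHom]
    exact (y.coeff q).2
  · intro h
    refine ⟨ofCoeff (Finsupp.onFinset x.coeff.support (fun q => ⟨x.coeff q, h q⟩) ?_), ?_⟩
    · intro q hq
      rw [Finsupp.mem_support_iff]
      exact fun h0 => hq (Subtype.ext h0)
    · rw [← coeff_inj]
      ext q
      rw [coeff_mapRingHom]
      rfl

lemma exists_inverse_mem_coeffsIn [Finite Q] {S : Subfield D} {x : MonoidAlgebra D Q}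
    (hS : x ∈ coeffsIn S) (hx : ∀ y, y ∈ coeffsIn S → y * x = 0 → y = 0) :
    ∃ y ∈ coeffsIn S, y * x = 1 ∧ x * y = 1 := by
  obtain ⟨x, rfl⟩ := hS
  have hinj : Function.Injective (mapRingHom Q S.subtype) := by
    intro a b hab
    rw [← coeff_inj] at hab ⊢
    ext q
    have := DFunLike.congr_fun hab q
    rw [coeff_mapRingHom, coeff_mapRingHom] at this
    exact this
  obtain ⟨y, h1, h2⟩ := exists_inverse_of_finite x fun y hy => by
    apply hinj
    rw [map_zero]
    exact hx _ ⟨y, rfl⟩ (by rw [← map_mul, hy, map_zero])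
  exact ⟨_, ⟨y, rfl⟩, by rw [← map_mul, h1, map_one], by rw [← map_mul, h2, map_one]⟩

lemma inverse_mem_coeffsIn [Finite Q] {S : Subfield D} {x y : MonoidAlgebra D Q}
    (hS : x ∈ coeffsIn S) (h1 : x * y = 1) : y ∈ coeffsIn S := by
  obtain ⟨z, hz, h2, -⟩ := exists_inverse_mem_coeffsIn hS fun z _ hz => by
    rw [← mul_one z, ← h1, ← mul_assoc, hz, zero_mul]
  rwa [← left_inv_eq_right_inv h2 h1]

/-- The elements with coefficients in the `m`-th step of the filtration. -/
noncomputable def coeffsInVal {B : Subfield D} {t : D} (h : TwistedLaurent.IsTwisted B t) (m : ℤ) :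
    AddSubgroup (MonoidAlgebra D Q) where
  carrier := {x | ∀ q, x.coeff q ∈ h.val m}
  zero_mem' := fun q => by simp
  add_mem' := fun hx hy q => by
    rw [coeff_add, Finsupp.add_apply]; exact add_mem (hx q) (hy q)
  neg_mem' := fun hx q => by
    rw [coeff_neg, Finsupp.neg_apply]; exact neg_mem (hx q)

variable {B : Subfield D} {t : D} {h : TwistedLaurent.IsTwisted B t}

lemma coeffsInVal_anti : Antitone (coeffsInVal (Q := Q) h) := fun _ _ hij _ hx q =>
  h.val_anti hij (hx q)

lemma mul_mem_coeffsInVal {i j : ℤ} {x y : MonoidAlgebra D Q} (hx : x ∈ coeffsInVal h i)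
    (hy : y ∈ coeffsInVal h j) : x * y ∈ coeffsInVal h (i + j) := by
  classical
  intro q
  rw [coeff_mul]
  refine sum_mem fun a _ => sum_mem fun b _ => ?_
  simp only
  split_ifs
  · exact h.val_mul (hx a) (hy b)
  · exact zero_mem _

lemma single_mem_coeffsInVal {i : ℤ} {q : Q} {d : D} (hd : d ∈ h.val i) :
    single q d ∈ coeffsInVal h i := by
  classical
  intro q'
  rw [coeff_single, Finsupp.single_apply]
  split_ifs
  · exact hd
  · exact zero_mem _

lemma one_mem_coeffsInVal : (1 : MonoidAlgebra D Q) ∈ coeffsInVal h 0 :=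
  single_mem_coeffsInVal (h.mem_val_zero B.one_mem)

lemma exists_mem_coeffsInVal [Finite Q] {x : MonoidAlgebra D Q} (hx : x ∈ coeffsIn h.fractions) :
    ∃ m, x ∈ coeffsInVal h m := by
  rw [mem_coeffsIn] at hx
  choose m hm using hx
  obtain ⟨l, hl⟩ := (Set.finite_range m).bddBelow
  exact ⟨l, fun q => h.val_anti (hl ⟨q, rfl⟩) (hm q)⟩

lemma coeffsInVal_unit [Finite Q] {x : MonoidAlgebra D Q} (hx : x ∈ coeffsInVal h 1) :
    ∃ y ∈ coeffsInVal h 0, (1 - x) * y = 1 ∧ y * (1 - x) = 1 := by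
  have h1 : (1 - x) ∈ coeffsIn (Q := Q) h.fractions :=
    sub_mem (one_mem _) (mem_coeffsIn.2 fun q => ⟨1, hx q⟩)
  have step : ∀ y z : MonoidAlgebra D Q, z ∈ coeffsInVal h 0 → y = z + y * x →
      (∃ m, y ∈ coeffsInVal h m) → y ∈ coeffsInVal h 0 := by
    rintro y z hz hy ⟨m, hm⟩
    have : ∀ n : ℕ, y ∈ coeffsInVal h (min 0 (m + n)) := by
      intro n
      induction n with
      | zero => exact coeffsInVal_anti (by simp) hm
      | succ n ih =>
        rw [hy]
        refine add_mem (coeffsInVal_anti (by simp) hz)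
          (coeffsInVal_anti ?_ (mul_mem_coeffsInVal ih hx))
        push_cast
        omega
    exact coeffsInVal_anti (by omega) (this (-m).toNat)
  obtain ⟨y, hy, e1, e2⟩ := exists_inverse_mem_coeffsIn h1 fun y hy e => by
    have e : y = y * x := by
      rw [mul_sub, mul_one, sub_eq_zero] at e; exact e
    obtain ⟨m, hm⟩ := exists_mem_coeffsInVal hy
    have : ∀ n : ℕ, y ∈ coeffsInVal h (m + n) := by
      intro n
      induction n with
      | zero => simpa using hm
      | succ n ih =>
        rw [e]
        push_cast
        rw [← add_assoc]
        exact mul_mem_coeffsInVal ih hx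
    rw [← coeff_inj]
    ext q
    exact h.val_sep fun i => h.val_anti (by omega) (this (i - m).toNat q)
  refine ⟨y, step y 1 one_mem_coeffsInVal ?_ (exists_mem_coeffsInVal hy), e2, e1⟩
  rw [← e1]; noncomm_ring

end Units

section Filtration

variable (φ) (N : Subgroup G) [N.Normal]

/-- The diagonal embedding of `G`. -/
noncomputable def diagHom : G →* MonoidAlgebra D (G ⧸ N) where
  toFun g := single (QuotientGroup.mk g) (φ (of k G g))
  map_one' := by rw [map_one, map_one]; rfl
  map_mul' x y := by rw [map_mul, map_mul, single_mul_single]; rfl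

/-- The scalars. -/
noncomputable def scalarHom : k →+* MonoidAlgebra D (G ⧸ N) :=
  singleOneRingHom.comp (φ.comp singleOneRingHom)

lemma scalarHom_mul_diagHom (c : k) (g : G) :
    scalarHom φ N c * diagHom φ N g = single (QuotientGroup.mk g) (φ (single g c)) := by
  simp [scalarHom, diagHom, single_mul_single, ← map_mul]

lemma commute_scalarHom_diagHom (c : k) (g : G) :
    Commute (scalarHom φ N c) (diagHom φ N g) := by
  rw [commute_iff_eq, scalarHom_mul_diagHom]
  simp [scalarHom, diagHom, single_mul_single, ← map_mul]

variable {φ N} in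
lemma coeffsIn_of_cx [Finite (G ⧸ N)] {s : Bool} {b : Cplx} {x : MonoidAlgebra D (G ⧸ N)}
    (hx : Cplx.Cx (scalarHom φ N) (diagHom φ N) L s b x) : x ∈ coeffsIn (divClosure φ L) := by
  induction hx with
  | unit c g hg =>
    classical
    rw [scalarHom_mul_diagHom, mem_coeffsIn]
    intro q
    rw [coeff_single, Finsupp.single_apply]
    split_ifs
    · exact apply_single_mem_divClosure hg c
    · exact zero_mem _
  | mul _ _ h1 h2 => exact mul_mem h1 h2
  | inv _ e1 e2 h => exact inverse_mem_coeffsIn h e1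
  | atom _ h => exact h
  | add _ _ h1 h2 => exact add_mem h1 h2

variable {φ N} in
/-- The filtration of the group ring of a finite quotient by order in `t`. -/
noncomputable def filt [Finite (G ⧸ N)] {t : G} (ht : ∀ i : ℤ, ∀ g ∈ L, t ^ i * g * (t ^ i)⁻¹ ∈ L)
    (h : TwistedLaurent.IsTwisted (divClosure φ L) (φ (of k G t))) :
    Cplx.Filt (scalarHom φ N) (diagHom φ N) L t where
  V := coeffsInVal h
  conj_mem := ht
  anti := coeffsInVal_anti
  mul_mem_V := mul_mem_coeffsInVal
  sep x hx := by
    rw [← coeff_inj]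
    ext q
    exact h.val_sep fun i => hx i q
  zpow_mem i := by
    refine single_mem_coeffsInVal ?_
    rw [apply_of_zpow]
    exact h.zpow_mem_val i
  base hx := fun q => h.mem_val_zero (mem_coeffsIn.1 (coeffsIn_of_cx hx) q)
  unit _ hx := coeffsInVal_unit hx

lemma _root_.IsHughesFreeEmbedding.exists_filt (hφ : IsHughesFreeEmbedding φ)
    (hG : LocallyIndicable G) [Finite (G ⧸ N)] (L : Subgroup G) (hL : L.FG) (hL' : L ≠ ⊥) :
    ∃ K t, Nonempty (Cplx.Filt (scalarHom φ N) (diagHom φ N) K t) ∧ Cplx.Cov K t L ∧ ¬ L ≤ K := by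
  obtain ⟨f, hf⟩ := hG L hL' hL
  obtain ⟨t, ht⟩ := hf (Multiplicative.ofAdd 1)
  set K : Subgroup G := f.ker.map L.subtype with hK
  have hKr : (L.subtype.comp f.ker.subtype).range = K := by
    rw [MonoidHom.range_comp, Subgroup.range_subtype]
  have htf : ∀ i : ℤ, f (t ^ i) = Multiplicative.ofAdd i := fun i => by
    rw [map_zpow, ht, ← ofAdd_zsmul, smul_eq_mul, mul_one]
  have hconj : ∀ i : ℤ, ∀ g ∈ K, (t : G) ^ i * g * ((t : G) ^ i)⁻¹ ∈ K := by
    rintro i _ ⟨g, hg, rfl⟩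
    exact ⟨t ^ i * g * (t ^ i)⁻¹, (MonoidHom.normal_ker f).conj_mem g hg (t ^ i), by simp⟩
  have htw : TwistedLaurent.IsTwisted (divClosure φ K) (φ (of k G t)) := by
    refine ⟨apply_of_ne_zero φ _, fun b hb i => ?_, ?_⟩
    · rw [← apply_of_zpow]
      exact conj_mem_divClosure (hconj i) hb
    · rw [linearIndependent_iff]
      intro l hl
      have := hφ.2.2 L hL f.ker t ⟨f, hf, rfl, ht⟩
        (l.mapRange (Subtype.val : divClosure φ K → D) rfl) (fun i => by
          rw [mem_divisionClosure_range_iff _ hKr]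
          exact (l i).2) (by
          rw [Finsupp.sum_mapRange_index (by simp)]
          rw [Finsupp.linearCombination_apply] at hl
          rw [← hl]
          refine Finsupp.sum_congr fun i _ => ?_
          rw [ringZPow_eq_zpow]
          rfl)
      ext i
      exact DFunLike.congr_fun this i
  refine ⟨K, t, ⟨filt hconj htw⟩, fun g hg => ?_, fun hle => ?_⟩
  · refine ⟨(f ⟨g, hg⟩).toAdd, g * (t : G) ^ (-(f ⟨g, hg⟩).toAdd), ?_, by simp⟩
    refine ⟨⟨g, hg⟩ * t ^ (-(f ⟨g, hg⟩).toAdd), ?_, by simp⟩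
    change f _ = 1
    rw [map_mul, htf]
    simp
  · obtain ⟨u, hu, hut⟩ := hle t.2
    have : u = t := Subtype.ext hut
    subst this
    rw [show f u = 1 from hu] at ht
    exact absurd (congrArg Multiplicative.toAdd ht) (by simp)

end Filtration

end MonoidAlgebra

lemma Cplx.Cx.exists_mul {k : Type*} [Field k] {G : Type*} [Group G] {A : Type*} [Ring A]
    {κ : k →+* A} {ψ : G →* A} {L : Subgroup G} {a b : Cplx} {x y : A}
    (hx : Cx κ ψ L false a x) (hy : Cx κ ψ L false b y) : ∃ c, Cx κ ψ L false c (x * y) := by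
  have key : ∀ {a x}, Cx κ ψ L true a x → ∃ c, Cx κ ψ L false c (x * y) := by
    intro a x hx
    generalize hs : false = s at hy
    induction hy with
    | unit c g hg => simp at hs
    | mul _ _ h1 h2 => simp at hs
    | inv _ h1 h2 h3 => simp at hs
    | atom h _ => exact ⟨_, .atom (hx.mul h)⟩
    | add h _ h1 h2 =>
      obtain ⟨c, hc⟩ := h2 hs
      rw [mul_add]; exact ⟨_, .add (hx.mul h) hc⟩
  generalize hs : false = s at hx
  induction hx with
  | unit c g hg => simp at hs
  | mul _ _ h1 h2 => simp at hs
  | inv _ h1 h2 h3 => simp at hs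
  | atom h _ => exact key h
  | add h _ h1 h2 =>
    obtain ⟨c, hc⟩ := h2 hs
    obtain ⟨c', hc'⟩ := key h
    rw [add_mul]
    exact ⟨_, hc'.sum_add hc⟩

namespace MonoidAlgebra

variable {k : Type*} [Field k] {G : Type*} [Group G] {D : Type*} [DivisionRing D]

section Support

variable {Q : Type*} [Group Q]

/-- The elements supported on a subgroup. -/
noncomputable def suppIn (D : Type*) [DivisionRing D] (P : Subgroup Q) :
    Subring (MonoidAlgebra D Q) where
  carrier := {x | ∀ q ∉ P, x.coeff q = 0}
  zero_mem' := fun q _ => by simp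
  one_mem' := fun q hq => by
    classical
    rw [one_def, coeff_single, Finsupp.single_apply, if_neg]
    rintro rfl
    exact hq P.one_mem
  add_mem' := fun hx hy q hq => by
    rw [coeff_add, Finsupp.add_apply, hx q hq, hy q hq, add_zero]
  neg_mem' := fun hx q hq => by
    rw [coeff_neg, Finsupp.neg_apply, hx q hq, neg_zero]
  mul_mem' := fun {x y} hx hy q hq => by
    classical
    rw [coeff_mul]
    refine Finset.sum_eq_zero fun a _ => Finset.sum_eq_zero fun b _ => ?_
    simp only
    split_ifs with hab
    · by_cases ha : a ∈ P
      · rw [hy b fun hb => hq (hab ▸ mul_mem ha hb), mul_zero]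
      · rw [hx a ha, zero_mul]
    · rfl

lemma inverse_mem_suppIn [Finite Q] {P : Subgroup Q} {x y : MonoidAlgebra D Q}
    (hx : x ∈ suppIn D P) (h1 : x * y = 1) : y ∈ suppIn D P := by
  let M : Submodule D (MonoidAlgebra D Q) :=
    { suppIn D P with
      smul_mem' := fun c x hx q hq => by
        rw [coeff_smul, Finsupp.smul_apply, hx q hq, smul_zero] }
  let f : MonoidAlgebra D Q →ₗ[D] MonoidAlgebra D Q :=
    { toFun := fun y => y * x
      map_add' := fun a b => add_mul a b x
      map_smul' := fun c a => smul_mul_assoc c a x }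
  have hinj : Function.Injective f := by
    rw [injective_iff_map_eq_zero]
    intro z hz
    have hz : z * x = 0 := hz
    rw [← mul_one z, ← h1, ← mul_assoc, hz, zero_mul]
  obtain ⟨z, hz, h2⟩ := (LinearMap.injOn_iff_surjOn (p := M) (f := f)
    (fun z hz => (suppIn D P).mul_mem hz hx)).1 hinj.injOn (one_mem (suppIn D P))
  have h2 : z * x = 1 := h2
  rwa [← left_inv_eq_right_inv h2 h1]

variable (D Q) in
/-- The augmentation. -/
noncomputable def augmentation : MonoidAlgebra D Q →+* D :=
  liftNCRingHom (RingHom.id D) (1 : Q →* D) (fun x _ => by simp)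

@[simp] lemma augmentation_single (q : Q) (d : D) : augmentation D Q (single q d) = d := by
  simp [augmentation]

end Support

section Basis

variable {φ : MonoidAlgebra k G →+* D} {N H : Subgroup G} [N.Normal]

/-- Membership in the rational closure of `k[G]` in the group ring of a finite quotient. -/
def IsRational (φ : MonoidAlgebra k G →+* D) (N : Subgroup G) [N.Normal]
    (x : MonoidAlgebra D (G ⧸ N)) : Prop :=
  ∃ a, Cplx.Cx (scalarHom φ N) (diagHom φ N) ⊤ false a x

lemma IsRational.add {x y : MonoidAlgebra D (G ⧸ N)} (hx : IsRational φ N x)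
    (hy : IsRational φ N y) : IsRational φ N (x + y) := by
  obtain ⟨a, hx⟩ := hx
  obtain ⟨b, hy⟩ := hy
  exact ⟨_, hx.sum_add hy⟩

lemma IsRational.mul {x y : MonoidAlgebra D (G ⧸ N)} (hx : IsRational φ N x)
    (hy : IsRational φ N y) : IsRational φ N (x * y) := by
  obtain ⟨a, hx⟩ := hx
  obtain ⟨b, hy⟩ := hy
  exact hx.exists_mul hy

lemma IsRational.neg {x : MonoidAlgebra D (G ⧸ N)} (hx : IsRational φ N x) :
    IsRational φ N (-x) := by
  obtain ⟨a, hx⟩ := hx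
  exact ⟨_, hx.neg⟩

lemma IsRational.inv {x y : MonoidAlgebra D (G ⧸ N)} (hx : IsRational φ N x)
    (h1 : x * y = 1) (h2 : y * x = 1) : IsRational φ N y := by
  obtain ⟨a, hx⟩ := hx
  exact ⟨_, .atom (.inv hx h1 h2)⟩

lemma isRational_single (g : G) (c : k) :
    IsRational φ N (single (QuotientGroup.mk g) (φ (single g c))) := by
  rw [← scalarHom_mul_diagHom]
  exact ⟨_, .atom (.unit c g (Subgroup.mem_top g))⟩

lemma isRational_zero : IsRational φ N 0 := by
  simpa using isRational_single (φ := φ) (N := N) 1 0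

lemma isRational_sum {ι : Type*} (s : Finset ι) (f : ι → MonoidAlgebra D (G ⧸ N))
    (h : ∀ i ∈ s, IsRational φ N (f i)) : IsRational φ N (∑ i ∈ s, f i) :=
  Finset.sum_induction _ _ (fun _ _ => IsRational.add) isRational_zero h

variable [Finite (G ⧸ N)]

lemma IsRational.eq_zero_or_isUnit (hφ : IsHughesFreeEmbedding φ) (hG : LocallyIndicable G)
    {x : MonoidAlgebra D (G ⧸ N)} (hx : IsRational φ N x) :
    x = 0 ∨ ∃ y, x * y = 1 ∧ y * x = 1 := by
  obtain ⟨a, hx⟩ := hx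
  exact Cplx.Cx.eq_zero_or_isUnit (commute_scalarHom_diagHom φ N)
    (IsHughesFreeEmbedding.exists_filt φ N hφ hG) a x hx

lemma IsRational.eq_zero (hφ : IsHughesFreeEmbedding φ) (hG : LocallyIndicable G)
    {x : MonoidAlgebra D (G ⧸ N)} (hx : IsRational φ N x) (h0 : augmentation D (G ⧸ N) x = 0) :
    x = 0 := by
  refine (hx.eq_zero_or_isUnit hφ hG).resolve_right ?_
  rintro ⟨y, h1, -⟩
  have := congrArg (augmentation D (G ⧸ N)) h1
  rw [map_mul, h0, zero_mul, map_one] at this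
  exact zero_ne_one this

lemma exists_isRational (hφ : IsHughesFreeEmbedding φ) (hG : LocallyIndicable G)
    {e : D} (he : e ∈ divClosure φ H) : ∃ x, IsRational φ N x ∧
      augmentation D (G ⧸ N) x = e ∧ x ∈ suppIn D (H.map (QuotientGroup.mk' N)) := by
  have hs : ∀ g ∈ H, ∀ c, ∃ x, IsRational φ N x ∧
      augmentation D (G ⧸ N) x = φ (single g c) ∧ x ∈ suppIn D (H.map (QuotientGroup.mk' N)) := by
    classical
    intro g hg c
    refine ⟨_, isRational_single g c, augmentation_single _ _, fun q hq => ?_⟩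
    rw [coeff_single, Finsupp.single_apply, if_neg]
    rintro rfl
    exact hq ⟨g, hg, rfl⟩
  induction he using Subfield.closure_induction with
  | mem x hx =>
    obtain ⟨g, hg, c, rfl⟩ := hx
    exact hs g hg c
  | one =>
    have := hs 1 H.one_mem 1
    rwa [← one_def, map_one] at this
  | add x y _ _ hx hy =>
    obtain ⟨x, h1, rfl, h3⟩ := hx
    obtain ⟨y, h1', rfl, h3'⟩ := hy
    exact ⟨_, h1.add h1', map_add _ _ _, add_mem h3 h3'⟩
  | mul x y _ _ hx hy =>
    obtain ⟨x, h1, rfl, h3⟩ := hx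
    obtain ⟨y, h1', rfl, h3'⟩ := hy
    exact ⟨_, h1.mul h1', map_mul _ _ _, mul_mem h3 h3'⟩
  | neg x _ hx =>
    obtain ⟨x, h1, rfl, h3⟩ := hx
    exact ⟨_, h1.neg, map_neg _ _, neg_mem h3⟩
  | inv x _ hx =>
    obtain ⟨x, h1, rfl, h3⟩ := hx
    rcases h1.eq_zero_or_isUnit hφ hG with rfl | ⟨y, h4, h5⟩
    · refine ⟨0, isRational_zero, ?_, zero_mem _⟩
      simp
    · refine ⟨y, h1.inv h4 h5, ?_, inverse_mem_suppIn h3 h4⟩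
      refine eq_inv_of_mul_eq_one_left ?_
      rw [← map_mul, h5, map_one]

lemma sum_apply_out_mul_eq_zero [Fintype (G ⧸ H)] (hφ : IsHughesFreeEmbedding φ)
    (hG : LocallyIndicable G) (hNH : N ≤ H) (e : G ⧸ H → D) (he : ∀ t, e t ∈ divClosure φ H)
    (h0 : ∑ t, φ (of k G t.out) * e t = 0) (t : G ⧸ H) : e t = 0 := by
  classical
  choose x hx1 hx2 hx3 using fun t => exists_isRational (N := N) hφ hG (he t)
  have hr : IsRational φ N (∑ t, single (QuotientGroup.mk t.out) (φ (of k G t.out)) * x t) :=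
    isRational_sum _ _ fun t _ => (isRational_single t.out 1).mul (hx1 t)
  have hz := hr.eq_zero hφ hG (by
    rw [map_sum, ← h0]
    refine Finset.sum_congr rfl fun t _ => ?_
    rw [map_mul, augmentation_single, hx2])
  have hmem : ∀ g : G, (QuotientGroup.mk g : G ⧸ N) ∈ H.map (QuotientGroup.mk' N) ↔ g ∈ H := by
    intro g
    have := Subgroup.comap_map_eq_self (f := QuotientGroup.mk' N) (H := H) (by simpa using hNH)
    conv_rhs => rw [← this]
    rfl
  suffices x t = 0 by rw [← hx2, this, map_zero]
  rw [← coeff_inj]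
  ext q
  by_cases hq : q ∈ H.map (QuotientGroup.mk' N)
  · have hc : ∀ (s : G ⧸ H) (q' : G ⧸ N),
        (single (QuotientGroup.mk s.out) (φ (of k G s.out)) * x s).coeff q' =
          φ (of k G s.out) * (x s).coeff ((QuotientGroup.mk s.out)⁻¹ * q') := fun s q' => by
      rw [← coeff_single_mul_mul, mul_inv_cancel_left]
    have := congrArg (fun y => y.coeff ((QuotientGroup.mk t.out : G ⧸ N) * q)) hz
    simp only [coeff_sum, Finsupp.finsetSum_apply, hc, coeff_zero, Finsupp.zero_apply] at this
    rw [Finset.sum_eq_single t, inv_mul_cancel_left] at this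
    · exact (mul_eq_zero.1 this).resolve_left (apply_of_ne_zero φ _)
    · intro s _ hst
      rw [hx3 s _, mul_zero]
      rw [← mul_assoc]
      intro hcon
      rw [Subgroup.mul_mem_cancel_right _ hq, ← QuotientGroup.mk_inv, ← QuotientGroup.mk_mul, hmem,
        ← QuotientGroup.eq] at hcon
      simp only [QuotientGroup.out_eq'] at hcon
      exact hst hcon
    · simp
  · exact hx3 t q hq

omit [N.Normal] [Finite (G ⧸ N)] in
lemma mem_span_of_mul (b : D) (hb : b ∈ divClosure φ N) (g : G) :
    b * φ (of k G g) ∈ Submodule.span (divClosure φ N) (Set.range fun g => φ (of k G g)) :=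
  Submodule.smul_mem _ (⟨b, hb⟩ : divClosure φ N) (Submodule.subset_span ⟨g, rfl⟩)

lemma span_range_apply_of (hφ : IsHughesFreeEmbedding φ) :
    Submodule.span (divClosure φ N) (Set.range fun g => φ (of k G g)) = ⊤ := by
  set F := divClosure φ N
  set M := Submodule.span F (Set.range fun g => φ (of k G g)) with hM
  have hconj : ∀ g : G, ∀ b ∈ F, φ (of k G g) * b * (φ (of k G g))⁻¹ ∈ F := fun g b hb =>
    conj_mem_divClosure (fun n hn => Subgroup.Normal.conj_mem inferInstance n hn g) hb
  have hfin : Module.Finite F M := by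
    refine Module.Finite.iff_fg.2 ⟨(Set.finite_range fun q : G ⧸ N => φ (of k G q.out)).toFinset, ?_⟩
    rw [Set.Finite.coe_toFinset]
    refine le_antisymm (Submodule.span_mono ?_) (Submodule.span_le.2 ?_)
    · rintro _ ⟨q, rfl⟩
      exact ⟨_, rfl⟩
    · rintro _ ⟨g, rfl⟩
      have hn : g * (QuotientGroup.mk g : G ⧸ N).out⁻¹ ∈ N := by
        refine (Subgroup.Normal.mem_comm_iff inferInstance).1 ?_
        rw [← QuotientGroup.eq, QuotientGroup.out_eq']
      have h1 : φ (of k G (g * (QuotientGroup.mk g : G ⧸ N).out⁻¹)) ∈ F :=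
        apply_single_mem_divClosure hn 1
      have : φ (of k G g) = φ (of k G (g * (QuotientGroup.mk g : G ⧸ N).out⁻¹)) *
          φ (of k G (QuotientGroup.mk g : G ⧸ N).out) := by
        rw [← map_mul, ← map_mul, inv_mul_cancel_right]
      simp only [SetLike.mem_coe]
      rw [this]
      exact Submodule.smul_mem _ (⟨_, h1⟩ : F) (Submodule.subset_span ⟨_, rfl⟩)
  have hmul : ∀ x ∈ M, ∀ y ∈ M, x * y ∈ M := by
    intro x hx y hy
    induction hx using Submodule.span_induction with
    | zero => simp
    | add x x' _ _ h1 h2 => rw [add_mul]; exact add_mem h1 h2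
    | smul b x _ h1 =>
      have : b • x * y = b • (x * y) := mul_assoc _ _ _
      rw [this]; exact M.smul_mem b h1
    | mem x hx =>
      obtain ⟨g, rfl⟩ := hx
      have h0 := apply_of_ne_zero φ g
      induction hy using Submodule.span_induction with
      | zero => simp
      | add x x' _ _ h1 h2 => rw [mul_add]; exact add_mem h1 h2
      | smul b y _ h1 =>
        have : φ (of k G g) * (b • y) = φ (of k G g) * b.1 * (φ (of k G g))⁻¹ *
            (φ (of k G g) * y) := by
          rw [show b • y = b.1 * y from rfl]
          rw [← mul_assoc (_ * _ * _), inv_mul_cancel_right₀ h0, mul_assoc]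
        simp only at h1 ⊢
        rw [this]
        exact M.smul_mem (⟨_, hconj g b.1 b.2⟩ : F) h1
      | mem y hy =>
        obtain ⟨g', rfl⟩ := hy
        simp only
        rw [← map_mul, ← map_mul]
        exact Submodule.subset_span ⟨_, rfl⟩
  have hone : (1 : D) ∈ M := Submodule.subset_span ⟨1, by simp only [map_one]⟩
  let S : Subfield D :=
    { M with
      mul_mem' := fun {x y} hx hy => hmul x hx y hy
      one_mem' := hone
      neg_mem' := fun hx => M.neg_mem hx
      inv_mem' := fun x hx => by
        by_cases h0 : x = 0
        · subst h0; rw [inv_zero]; exact zero_mem M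
        let f : D →ₗ[F] D :=
          { toFun := fun y => y * x
            map_add' := fun a b => add_mul a b x
            map_smul' := fun c a => smul_mul_assoc c a x }
        have hinj : Function.Injective f := mul_left_injective₀ h0
        obtain ⟨y, hy, h1⟩ := (LinearMap.injOn_iff_surjOn (p := M) (f := f)
          (fun z hz => hmul _ hz _ hx)).1 hinj.injOn hone
        have h1 : y * x = 1 := h1
        rwa [inv_eq_of_mul_eq_one_left h1] }
  have hS : divClosure φ ⊤ ≤ S := by
    refine Subfield.closure_le.2 ?_
    rintro _ ⟨g, -, c, rfl⟩
    have : φ (single g c) = φ (single 1 c) * φ (of k G g) := by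
      rw [← map_mul, of_apply, single_mul_single]; simp
    rw [this]
    exact mem_span_of_mul _ (apply_single_mem_divClosure N.one_mem c) g
  rw [eq_top_iff]
  intro x _
  refine hS ?_
  rw [← mem_divisionClosure_range_iff (MonoidHom.id G) (L := ⊤)
    (MonoidHom.range_eq_top.2 Function.surjective_id)]
  have : Set.range (φ.comp (mapDomainRingHom k (MonoidHom.id G))) = Set.range φ := by
    rw [mapDomainRingHom_id, RingHom.comp_id]
  rw [this, hφ.2.1]
  trivial

lemma exists_sum_apply_out_mul [Fintype (G ⧸ H)] (hφ : IsHughesFreeEmbedding φ) (hNH : N ≤ H)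
    (d : D) : ∃ e : G ⧸ H → D, (∀ t, e t ∈ divClosure φ H) ∧
      ∑ t, φ (of k G t.out) * e t = d := by
  classical
  have hd : d ∈ Submodule.span (divClosure φ N) (Set.range fun g => φ (of k G g)) := by
    rw [span_range_apply_of hφ]; trivial
  induction hd using Submodule.span_induction with
  | zero => exact ⟨0, fun t => zero_mem _, by simp⟩
  | add x y _ _ h1 h2 =>
    obtain ⟨e, he, rfl⟩ := h1
    obtain ⟨e', he', rfl⟩ := h2
    exact ⟨e + e', fun t => add_mem (he t) (he' t), by simp [mul_add, Finset.sum_add_distrib]⟩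
  | smul b x _ h1 =>
    obtain ⟨e, he, rfl⟩ := h1
    have hle : divClosure φ N ≤ divClosure φ H := Subfield.closure_mono (by
      rintro _ ⟨g, hg, c, rfl⟩
      exact ⟨g, hNH hg, c, rfl⟩)
    refine ⟨fun t => φ (of k G t.out⁻¹) * b.1 * (φ (of k G t.out⁻¹))⁻¹ * e t, fun t => ?_, ?_⟩
    · exact mul_mem (hle (conj_mem_divClosure
        (fun n hn => Subgroup.Normal.conj_mem inferInstance n hn _) b.2)) (he t)
    · rw [show ∀ y : D, b • y = b.1 * y from fun _ => rfl, Finset.mul_sum]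
      refine Finset.sum_congr rfl fun t _ => ?_
      simp only [apply_of_inv, inv_inv]
      simp only [mul_assoc, mul_inv_cancel_left₀ (apply_of_ne_zero φ _)]
  | mem x hx =>
    obtain ⟨g, rfl⟩ := hx
    refine ⟨Pi.single (QuotientGroup.mk g)
      (φ (of k G ((QuotientGroup.mk g : G ⧸ H).out⁻¹ * g))), fun t => ?_, ?_⟩
    · rw [Pi.single_apply]
      split_ifs
      · refine apply_single_mem_divClosure ?_ 1
        rw [← QuotientGroup.eq, QuotientGroup.out_eq']
      · exact zero_mem _
    · rw [Finset.sum_eq_single (QuotientGroup.mk g)]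
      · rw [Pi.single_eq_same, ← map_mul, ← map_mul, mul_inv_cancel_left]
      · intro t _ ht
        rw [Pi.single_eq_of_ne ht, mul_zero]
      · simp

end Basis

end MonoidAlgebra

namespace HomogeneousChains

open Finsupp

variable (E : Type*) [Ring E] {X X' : Type*}

/-- The differential of the complex of homogeneous chains on a set. -/
noncomputable def d (X : Type*) (n : ℕ) :
    ((Fin (n + 2) → X) →₀ E) →ₗ[Eᵐᵒᵖ] ((Fin (n + 1) → X) →₀ E) :=
  ∑ i : Fin (n + 2), (-1 : ℤ) ^ (i : ℕ) • lmapDomain E Eᵐᵒᵖ (fun x : Fin (n + 2) → X =>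
    x ∘ i.succAbove)

/-- The cone operator with apex `w`. -/
noncomputable def cone (w : X) (n : ℕ) :
    ((Fin n → X) →₀ E) →ₗ[Eᵐᵒᵖ] ((Fin (n + 1) → X) →₀ E) :=
  lmapDomain E Eᵐᵒᵖ fun x : Fin n → X => (Fin.cons w x : Fin (n + 1) → X)

/-- The map on homogeneous chains induced by a map of sets. -/
noncomputable def push (f : X → X') (n : ℕ) :
    ((Fin n → X) →₀ E) →ₗ[Eᵐᵒᵖ] ((Fin n → X') →₀ E) :=
  lmapDomain E Eᵐᵒᵖ (fun x => f ∘ x)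

/-- Left multiplication of all coefficients. -/
noncomputable def scale {E : Type*} [Ring E] {T : Type*} (c : E) : (T →₀ E) →ₗ[Eᵐᵒᵖ] (T →₀ E) :=
  Finsupp.mapRange.linearMap (lmulLeft c)

variable {E}

@[simp] lemma scale_single {T : Type*} (c : E) (t : T) (e : E) :
    scale c (single t e) = single t (c * e) := by
  simp [scale, lmulLeft]

@[simp] lemma cone_single (w : X) {n : ℕ} (x : Fin n → X) (e : E) :
    cone E w n (single x e) = single (Fin.cons w x) e := mapDomain_single

@[simp] lemma push_single (f : X → X') {n : ℕ} (x : Fin n → X) (e : E) :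
    push E f n (single x e) = single (f ∘ x) e := mapDomain_single

lemma d_single {n : ℕ} (x : Fin (n + 2) → X) (e : E) :
    d E X n (single x e) = ∑ i : Fin (n + 2), (-1 : ℤ) ^ (i : ℕ) • single (x ∘ i.succAbove) e := by
  simp [d, LinearMap.sum_apply, mapDomain_single]

lemma cons_comp_succAbove_succ {n : ℕ} (w : X) (x : Fin (n + 1) → X) (i : Fin (n + 1)) :
    (Fin.cons w x : Fin (n + 2) → X) ∘ i.succ.succAbove = Fin.cons w (x ∘ i.succAbove) := by
  funext j
  refine Fin.cases ?_ (fun j => ?_) j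
  · simp
  · simp [Fin.succ_succAbove_succ]

lemma single_eq_cone {n : ℕ} (x : Fin (n + 1) → X) (e : E) :
    single x e = cone E (x 0) n (single (Fin.tail x) e) := by
  rw [cone_single, Fin.cons_self_tail]

/-- Linear maps out of the chains of positive degree agree if they agree on cones. -/
lemma ext_cone {n : ℕ} {M : Type*} [AddCommGroup M] [Module Eᵐᵒᵖ M]
    {f g : ((Fin (n + 1) → X) →₀ E) →ₗ[Eᵐᵒᵖ] M}
    (h : ∀ w y, f (cone E w n y) = g (cone E w n y)) : f = g := by
  refine Finsupp.lhom_ext fun x e => ?_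
  rw [single_eq_cone, h]

lemma d_cone (w : X) (n : ℕ) (y : (Fin (n + 2) → X) →₀ E) :
    d E X (n + 1) (cone E w _ y) = y - cone E w _ (d E X n y) := by
  induction y using Finsupp.induction_linear with
  | zero => simp
  | add y z hy hz => simp only [map_add, hy, hz]; abel
  | single x e =>
    rw [cone_single, d_single, Fin.sum_univ_succ, d_single, map_sum, sub_eq_add_neg,
      ← Finset.sum_neg_distrib]
    congr 1
    · simp
    · refine Finset.sum_congr rfl fun i _ => ?_
      rw [cons_comp_succAbove_succ, map_zsmul, cone_single, Fin.val_succ, pow_succ]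
      simp

lemma d_zero_single (x : Fin 2 → X) (e : E) :
    d E X 0 (single x e) = single (fun _ => x 1) e - single (fun _ => x 0) e := by
  rw [d_single, Fin.sum_univ_two, sub_eq_add_neg]
  congr 1
  · simp only [Fin.val_zero, pow_zero, one_smul]
    congr 1
    funext j
    fin_cases j
    rfl
  · simp only [Fin.val_one, pow_one, neg_smul, one_smul]
    congr 2
    funext j
    fin_cases j
    rfl

lemma push_cone (f : X → X') (w : X) (n : ℕ) (y : (Fin n → X) →₀ E) :
    push E f _ (cone E w n y) = cone E (f w) n (push E f _ y) := by
  induction y using Finsupp.induction_linear with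
  | zero => simp
  | add y z hy hz => simp only [map_add, hy, hz]
  | single x e =>
    simp only [cone_single, push_single]
    congr 1
    funext j
    refine Fin.cases ?_ (fun j => ?_) j <;> simp

lemma push_d (f : X → X') (n : ℕ) (y : (Fin (n + 2) → X) →₀ E) :
    push E f _ (d E X n y) = d E X' n (push E f _ y) := by
  induction y using Finsupp.induction_linear with
  | zero => simp
  | add y z hy hz => simp only [map_add, hy, hz]
  | single x e =>
    rw [d_single, push_single, d_single, map_sum]
    refine Finset.sum_congr rfl fun i _ => ?_
    rw [map_zsmul, push_single]
    rfl

lemma scale_cone (c : E) (w : X) (n : ℕ) (y : (Fin n → X) →₀ E) :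
    scale c (cone E w n y) = cone E w n (scale c y) := by
  induction y using Finsupp.induction_linear with
  | zero => simp
  | add y z hy hz => simp only [map_add, hy, hz]
  | single x e => simp only [cone_single, scale_single]

lemma scale_push (c : E) (f : X → X') (n : ℕ) (y : (Fin n → X) →₀ E) :
    scale c (push E f n y) = push E f n (scale c y) := by
  induction y using Finsupp.induction_linear with
  | zero => simp
  | add y z hy hz => simp only [map_add, hy, hz]
  | single x e => simp only [push_single, scale_single]

variable (E) in
/-- The prism operator: a chain homotopy between the maps induced by `f` and `g`. -/
noncomputable def prism (f g : X → X') :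
    (n : ℕ) → ((Fin (n + 1) → X) →₀ E) →ₗ[Eᵐᵒᵖ] ((Fin (n + 2) → X') →₀ E)
  | 0 => lmapDomain E Eᵐᵒᵖ (fun x => ![f (x 0), g (x 0)])
  | n + 1 => Finsupp.lsum ℕ fun x =>
      cone E (f (x 0)) _ ∘ₗ (push E g _ ∘ₗ lsingle x - prism f g n ∘ₗ lsingle (Fin.tail x))

lemma prism_zero_single (f g : X → X') (x : Fin 1 → X) (e : E) :
    prism E f g 0 (single x e) = single ![f (x 0), g (x 0)] e := mapDomain_single

lemma prism_cone (f g : X → X') (n : ℕ) (w : X) (y : (Fin (n + 1) → X) →₀ E) :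
    prism E f g (n + 1) (cone E w _ y) =
      cone E (f w) _ (cone E (g w) _ (push E g _ y) - prism E f g n y) := by
  induction y using Finsupp.induction_linear with
  | zero => simp
  | add y z hy hz => simp only [map_add, hy, hz, map_sub]; abel
  | single x e =>
    rw [← push_cone, cone_single]
    simp [prism]

lemma d_prism_zero (f g : X → X') (y : (Fin 1 → X) →₀ E) :
    d E X' 0 (prism E f g 0 y) = push E g _ y - push E f _ y := by
  induction y using Finsupp.induction_linear with
  | zero => simp
  | add y z hy hz => simp only [map_add, hy, hz]; abel
  | single x e =>
    rw [prism_zero_single, d_zero_single, push_single, push_single]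
    have : ∀ u : X → X', u ∘ x = fun _ => u (x 0) := fun u => by
      funext j
      rw [Function.comp_apply, Subsingleton.elim j 0]
    simp [this]

lemma d_prism (f g : X → X') (n : ℕ) (y : (Fin (n + 2) → X) →₀ E) :
    d E X' (n + 1) (prism E f g (n + 1) y) + prism E f g n (d E X n y) =
      push E g _ y - push E f _ y := by
  induction n with
  | zero =>
    suffices h : d E X' 1 ∘ₗ prism E f g 1 + prism E f g 0 ∘ₗ d E X 0 =
        push E g _ - push E f _ from LinearMap.congr_fun h y
    refine Finsupp.lhom_ext fun x e => ?_
    simp only [LinearMap.add_apply, LinearMap.comp_apply, LinearMap.sub_apply]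
    have h1 : prism E f g 1 (single x e) = single ![f (x 0), g (x 0), g (x 1)] e -
        single ![f (x 0), f (x 1), g (x 1)] e := by
      rw [single_eq_cone x, prism_cone, prism_zero_single, push_single, cone_single, map_sub,
        cone_single, cone_single]
      congr 2
      funext j
      fin_cases j <;> rfl
    rw [h1, map_sub, d_zero_single, map_sub, prism_zero_single, prism_zero_single, d_single,
      d_single, Fin.sum_univ_three, Fin.sum_univ_three, push_single, push_single]
    have e1 : ∀ a b c : X', ![a, b, c] ∘ (0 : Fin 3).succAbove = ![b, c] := fun a b c => by
      funext j; fin_cases j <;> rfl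
    have e2 : ∀ a b c : X', ![a, b, c] ∘ (1 : Fin 3).succAbove = ![a, c] := fun a b c => by
      funext j; fin_cases j <;> rfl
    have e3 : ∀ a b c : X', ![a, b, c] ∘ (2 : Fin 3).succAbove = ![a, b] := fun a b c => by
      funext j; fin_cases j <;> rfl
    have e4 : ∀ u : X → X', u ∘ x = ![u (x 0), u (x 1)] := fun u => by
      funext j; fin_cases j <;> rfl
    simp only [e1, e2, e3, e4, Fin.val_zero, Fin.val_one, Fin.val_two, pow_zero, pow_one, one_smul,
      neg_smul, even_two, Even.neg_pow, one_pow]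
    abel
  | succ n ih =>
    suffices h : d E X' (n + 2) ∘ₗ prism E f g (n + 2) + prism E f g (n + 1) ∘ₗ d E X (n + 1) =
        push E g _ - push E f _ from LinearMap.congr_fun h y
    refine ext_cone fun w y => ?_
    simp only [LinearMap.add_apply, LinearMap.comp_apply, LinearMap.sub_apply]
    rw [prism_cone, d_cone, d_cone, map_sub (prism E f g _), prism_cone, map_sub (d E X' _),
      d_cone, eq_sub_of_add_eq (ih y), push_d, push_cone, push_cone]
    simp only [map_sub]
    abel

lemma scale_prism (c : E) (f g : X → X') (n : ℕ) (y : (Fin (n + 1) → X) →₀ E) :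
    scale c (prism E f g n y) = prism E f g n (scale c y) := by
  induction n with
  | zero =>
    induction y using Finsupp.induction_linear with
    | zero => simp
    | add y z hy hz => simp only [map_add, hy, hz]
    | single x e => simp only [prism_zero_single, scale_single]
  | succ n ih =>
    suffices h : scale c ∘ₗ prism E f g (n + 1) = prism E f g (n + 1) ∘ₗ scale c from
      LinearMap.congr_fun h y
    refine ext_cone fun w y => ?_
    simp only [LinearMap.comp_apply]
    rw [prism_cone, scale_cone, scale_cone, prism_cone, map_sub (scale c), ih, scale_cone,
      scale_push]

lemma push_prism {f g : X → X'} {α : X → X} {β : X' → X'} (hf : ∀ x, f (α x) = β (f x))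
    (hg : ∀ x, g (α x) = β (g x)) (n : ℕ) (y : (Fin (n + 1) → X) →₀ E) :
    push E β _ (prism E f g n y) = prism E f g n (push E α _ y) := by
  induction n with
  | zero =>
    induction y using Finsupp.induction_linear with
    | zero => simp
    | add y z hy hz => simp only [map_add, hy, hz]
    | single x e =>
      simp only [prism_zero_single, push_single, Function.comp_apply, hf, hg]
      congr 1
      funext j
      fin_cases j <;> rfl
  | succ n ih =>
    suffices h : push E β _ ∘ₗ prism E f g (n + 1) = prism E f g (n + 1) ∘ₗ push E α _ from
      LinearMap.congr_fun h y
    refine ext_cone fun w y => ?_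
    simp only [LinearMap.comp_apply]
    have hpp : ∀ z : (Fin (n + 1) → X) →₀ E, push E β _ (push E g _ z) =
        push E g _ (push E α _ z) := fun z => by
      induction z using Finsupp.induction_linear with
      | zero => simp
      | add y z hy hz => simp only [map_add, hy, hz]
      | single x e =>
        simp only [push_single]
        congr 1
        funext j
        exact (hg _).symm
    rw [prism_cone, push_cone, push_cone, prism_cone, map_sub (push E β _), ih, push_cone, hpp,
      hf, hg]

end HomogeneousChains

/-- A semilinear map that is bijective up to boundaries induces a bijection on homology. -/
lemma Submodule.exists_addEquiv_map_mkQ {R S M M' : Type*} [Ring R] [Ring S] [AddCommGroup M]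
    [Module R M] [AddCommGroup M'] [Module S M'] {ρ : R →+* S} (f : M →ₛₗ[ρ] M')
    {Z B : Submodule R M} {Z' B' : Submodule S M'} (hZ : ∀ z ∈ Z, f z ∈ Z')
    (hB : ∀ b ∈ B, f b ∈ B') (hinj : ∀ z ∈ Z, f z ∈ B' → z ∈ B)
    (hsurj : ∀ z' ∈ Z', ∃ z ∈ Z, f z - z' ∈ B') :
    ∃ Φ : ↥(Z.map B.mkQ) ≃+ ↥(Z'.map B'.mkQ), ∀ (r : R) x, Φ (r • x) = ρ r • Φ x := by
  let F : M ⧸ B →ₛₗ[ρ] M' ⧸ B' := B.mapQ B' f hB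
  have hF : ∀ x ∈ Z.map B.mkQ, F x ∈ Z'.map B'.mkQ := by
    rintro _ ⟨z, hz, rfl⟩
    exact ⟨f z, hZ z hz, rfl⟩
  let g : ↥(Z.map B.mkQ) →+ ↥(Z'.map B'.mkQ) :=
    { toFun := fun x => ⟨F x.1, hF x.1 x.2⟩
      map_zero' := Subtype.ext (map_zero F)
      map_add' := fun x y => Subtype.ext (map_add F x.1 y.1) }
  have hg : Function.Bijective g := by
    constructor
    · rw [injective_iff_map_eq_zero]
      rintro ⟨_, z, hz, rfl⟩ h
      have h : B'.mkQ (f z) = 0 := congrArg Subtype.val h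
      refine Subtype.ext ?_
      rw [Submodule.mkQ_apply, Submodule.Quotient.mk_eq_zero] at h
      exact (Submodule.Quotient.mk_eq_zero _).2 (hinj z hz h)
    · rintro ⟨_, z', hz', rfl⟩
      obtain ⟨z, hz, h⟩ := hsurj z' hz'
      exact ⟨⟨B.mkQ z, z, hz, rfl⟩, Subtype.ext ((Submodule.Quotient.eq _).2 h)⟩
  exact ⟨AddEquiv.ofBijective g hg, fun r x => Subtype.ext (map_smulₛₗ F r x.1)⟩

namespace HomogeneousChains

open Finsupp

variable {E : Type*} [Ring E] {X X' : Type*} {Λ : Type*}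

/-- The submodule of chains that are killed by passing to coinvariants. -/
noncomputable def orbitRel (act : Λ → X → X) (σ : Λ → E) (n : ℕ) :
    Submodule Eᵐᵒᵖ ((Fin n → X) →₀ E) :=
  Submodule.span Eᵐᵒᵖ
    {y | ∃ h x e, y = scale (σ h) (push E (act h) n (single x e)) - single x e}

/-- Chains which become cycles in the coinvariants. -/
noncomputable def cycles (act : Λ → X → X) (σ : Λ → E) :
    (n : ℕ) → Submodule Eᵐᵒᵖ ((Fin (n + 1) → X) →₀ E)
  | 0 => ⊤
  | n + 1 => (orbitRel act σ (n + 1)).comap (d E X n)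

/-- Chains which become boundaries in the coinvariants. -/
noncomputable def boundaries (act : Λ → X → X) (σ : Λ → E) (n : ℕ) :
    Submodule Eᵐᵒᵖ ((Fin (n + 1) → X) →₀ E) :=
  LinearMap.range (d E X n) ⊔ orbitRel act σ (n + 1)

variable {act : Λ → X → X} {act' : Λ → X' → X'} {σ : Λ → E}

lemma scale_push_sub_mem_orbitRel (h : Λ) {n : ℕ} (y : (Fin n → X) →₀ E) :
    scale (σ h) (push E (act h) n y) - y ∈ orbitRel act σ n := by
  induction y using Finsupp.induction_linear with
  | zero => simp
  | add y z hy hz =>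
    rw [map_add, map_add, add_sub_add_comm]
    exact add_mem hy hz
  | single x e => exact Submodule.subset_span ⟨h, x, e, rfl⟩

lemma map_mem_orbitRel {n m : ℕ} {f : ((Fin n → X) →₀ E) →ₗ[Eᵐᵒᵖ] ((Fin m → X') →₀ E)}
    (hf : ∀ h y, f (scale (σ h) (push E (act h) n y)) = scale (σ h) (push E (act' h) m (f y)))
    {y : (Fin n → X) →₀ E} (hy : y ∈ orbitRel act σ n) : f y ∈ orbitRel act' σ m := by
  suffices orbitRel act σ n ≤ (orbitRel act' σ m).comap f from this hy
  refine Submodule.span_le.2 ?_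
  rintro _ ⟨h, x, e, rfl⟩
  rw [SetLike.mem_coe, Submodule.mem_comap, map_sub, hf]
  exact scale_push_sub_mem_orbitRel h _

lemma push_push {X'' : Type*} (f : X → X') (g : X' → X'') (n : ℕ) (y : (Fin n → X) →₀ E) :
    push E g n (push E f n y) = push E (g ∘ f) n y := by
  induction y using Finsupp.induction_linear with
  | zero => simp
  | add y z hy hz => simp only [map_add, hy, hz]
  | single x e => simp only [push_single, Function.comp_assoc]

lemma push_id (n : ℕ) (y : (Fin n → X) →₀ E) : push E id n y = y := by
  induction y using Finsupp.induction_linear with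
  | zero => simp
  | add y z hy hz => simp only [map_add, hy, hz]
  | single x e => simp only [push_single, Function.id_comp]

lemma push_mem_orbitRel {f : X → X'} (hf : ∀ h x, f (act h x) = act' h (f x)) {n : ℕ}
    {y : (Fin n → X) →₀ E} (hy : y ∈ orbitRel act σ n) : push E f n y ∈ orbitRel act' σ n :=
  map_mem_orbitRel (fun h y => by
    rw [← scale_push, push_push, push_push]
    congr 3
    funext x
    exact hf h x) hy

lemma prism_mem_orbitRel {f g : X → X'} (hf : ∀ h x, f (act h x) = act' h (f x))
    (hg : ∀ h x, g (act h x) = act' h (g x)) {n : ℕ} {y : (Fin (n + 1) → X) →₀ E}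
    (hy : y ∈ orbitRel act σ (n + 1)) : prism E f g n y ∈ orbitRel act' σ (n + 2) :=
  map_mem_orbitRel (fun h y => by rw [← scale_prism, push_prism (hf h) (hg h)]) hy

lemma push_mem_cycles {f : X → X'} (hf : ∀ h x, f (act h x) = act' h (f x)) {n : ℕ}
    {y : (Fin (n + 1) → X) →₀ E} (hy : y ∈ cycles act σ n) : push E f _ y ∈ cycles act' σ n := by
  cases n with
  | zero => trivial
  | succ n =>
    change d E X' n (push E f _ y) ∈ orbitRel act' σ (n + 1)
    rw [← push_d]
    exact push_mem_orbitRel hf hy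

lemma push_mem_boundaries {f : X → X'} (hf : ∀ h x, f (act h x) = act' h (f x)) {n : ℕ}
    {y : (Fin (n + 1) → X) →₀ E} (hy : y ∈ boundaries act σ n) :
    push E f _ y ∈ boundaries act' σ n := by
  obtain ⟨_, ⟨a, rfl⟩, w, hw, rfl⟩ := Submodule.mem_sup.1 hy
  rw [map_add, push_d]
  exact add_mem (Submodule.mem_sup_left ⟨_, rfl⟩)
    (Submodule.mem_sup_right (push_mem_orbitRel hf hw))

lemma push_sub_push_mem_boundaries {f g : X → X'} (hf : ∀ h x, f (act h x) = act' h (f x))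
    (hg : ∀ h x, g (act h x) = act' h (g x)) {n : ℕ} {y : (Fin (n + 1) → X) →₀ E}
    (hy : y ∈ cycles act σ n) : push E g _ y - push E f _ y ∈ boundaries act' σ n := by
  cases n with
  | zero =>
    rw [← d_prism_zero]
    exact Submodule.mem_sup_left ⟨_, rfl⟩
  | succ n =>
    rw [← d_prism]
    exact add_mem (Submodule.mem_sup_left ⟨_, rfl⟩)
      (Submodule.mem_sup_right (prism_mem_orbitRel hf hg hy))

/-- Equivariant maps in both directions induce an isomorphism of the homology of coinvariants. -/
lemma exists_addEquiv_push {f : X → X'} {g : X' → X} (hf : ∀ h x, f (act h x) = act' h (f x))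
    (hg : ∀ h x, g (act' h x) = act h (g x)) (n : ℕ) :
    ∃ Φ : ↥((cycles act σ n).map (boundaries act σ n).mkQ) ≃+
        ↥((cycles act' σ n).map (boundaries act' σ n).mkQ),
      ∀ (r : Eᵐᵒᵖ) x, Φ (r • x) = r • Φ x := by
  have hgf : ∀ h x, (g ∘ f) (act h x) = act h ((g ∘ f) x) := fun h x => by
    rw [Function.comp_apply, hf, hg, Function.comp_apply]
  have hfg : ∀ h x, (f ∘ g) (act' h x) = act' h ((f ∘ g) x) := fun h x => by
    rw [Function.comp_apply, hg, hf, Function.comp_apply]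
  refine Submodule.exists_addEquiv_map_mkQ (push E f (n + 1)) (fun z => push_mem_cycles hf)
    (fun b => push_mem_boundaries hf) (fun z hz h => ?_)
    (fun z' hz' => ⟨push E g _ z', push_mem_cycles hg hz', ?_⟩)
  · have h1 := push_mem_boundaries hg h
    have h2 := push_sub_push_mem_boundaries (act := act) (act' := act) hgf (g := id)
      (fun _ _ => rfl) hz
    rw [push_push] at h1
    rw [push_id] at h2
    rw [← sub_add_cancel z (push E (g ∘ f) _ z)]
    exact add_mem h2 h1
  · have h2 := push_sub_push_mem_boundaries (act := act') (act' := act') (f := id) (fun _ _ => rfl)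
      hfg hz'
    rwa [push_id, ← push_push] at h2

end HomogeneousChains

namespace HomogeneousChains

open Finsupp

section Bar

variable {Γ : Type*} [Group Γ] {E D : Type*} [Ring E] [Ring D]

/-- The successive quotients of a tuple of group elements. -/
def quotients {n : ℕ} (x : Fin (n + 1) → Γ) : Fin n → Γ := fun i => (x i.castSucc)⁻¹ * x i.succ

/-- The comparison map from homogeneous chains to inhomogeneous chains. -/
noncomputable def toBar (j : E →+* D) (σ : Γ →* D) (n : ℕ) :
    ((Fin (n + 1) → Γ) →₀ E) →ₛₗ[RingHom.op j] ((Fin n → Γ) →₀ D) where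
  toFun := liftAddHom fun x => (singleAddHom (quotients x)).comp
    ((AddMonoidHom.mulLeft (σ (x 0)⁻¹)).comp j.toAddMonoidHom)
  map_add' := map_add _
  map_smul' r y := by
    induction y using Finsupp.induction_linear with
    | zero => simp
    | add y z hy hz => simp only [smul_add, map_add, hy, hz]
    | single x e =>
      rw [smul_single, liftAddHom_apply_single, liftAddHom_apply_single]
      simp only [AddMonoidHom.comp_apply, singleAddHom_apply, smul_single]
      congr 1
      simp [mul_assoc]

lemma toBar_single (j : E →+* D) (σ : Γ →* D) {n : ℕ} (x : Fin (n + 1) → Γ) (e : E) :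
    toBar j σ n (single x e) = single (quotients x) (σ (x 0)⁻¹ * j e) :=
  liftAddHom_apply_single _ _ _

lemma zsmul_single_neg_one {T : Type*} (m : ℕ) (t : T) (c : D) :
    (-1 : ℤ) ^ m • single t c = single t ((-1 : D) ^ m * c) := by
  rw [smul_single, zsmul_eq_mul]
  push_cast
  rfl

lemma barFace_quotients {n : ℕ} (x : Fin (n + 2) → Γ) (i : Fin n) :
    barFace i (quotients x) = quotients (x ∘ i.castSucc.succ.succAbove) := by
  funext l
  simp only [barFace, quotients, Function.comp_apply]
  rcases lt_trichotomy (l : ℕ) i with h | h | h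
  · rw [if_pos h, Fin.succAbove_of_castSucc_lt _ _ (Nat.lt_succ_of_lt h),
      Fin.succAbove_of_castSucc_lt _ _ (Nat.succ_lt_succ h), Fin.succ_castSucc]
  · have h' : l = i := Fin.ext h
    subst h'
    rw [if_neg (lt_irrefl _), if_pos rfl, Fin.succAbove_of_castSucc_lt _ _ (Nat.lt_succ_self _),
      Fin.succAbove_of_le_castSucc _ _ (le_refl (_ + 1)), Fin.succ_castSucc]
    group
  · rw [if_neg (by omega), if_neg (by omega),
      Fin.succAbove_of_le_castSucc _ _ (show (i : ℕ) + 1 ≤ l from h),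
      Fin.succAbove_of_le_castSucc _ _ (Nat.succ_le_succ h.le), Fin.succ_castSucc]

lemma barBoundary_toBar (j : E →+* D) (σ : Γ →* D) (n : ℕ) (y : (Fin (n + 2) → Γ) →₀ E) :
    barBoundary σ n (toBar j σ (n + 1) y) = toBar j σ n (d E Γ n y) := by
  induction y using Finsupp.induction_linear with
  | zero => simp
  | add y z hy hz => simp only [map_add, hy, hz]
  | single x e =>
    have hc : ∀ (m : ℕ) (c : D), c * j ((-1) ^ m * e) = (-1) ^ m * (c * j e) := fun m c => by
      rw [map_mul, map_pow, map_neg, map_one, ← mul_assoc,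
        ← ((Commute.neg_one_left c).pow_left m).eq, mul_assoc]
    rw [toBar_single, d_single, Fin.sum_univ_succ, Fin.sum_univ_castSucc, barBoundary,
      Finsupp.lsum_single, barTerm]
    simp only [map_add, map_sum, toBar_single, zsmul_single_neg_one,
      LinearMap.add_apply, LinearMap.sum_apply, LinearMap.comp_apply, lsingle_apply]
    simp only [← add_assoc]
    congr 2
    · rw [Fin.val_zero, pow_zero, one_mul]
      congr 1
      simp [lmulLeft, quotients, ← mul_assoc, ← map_mul]
    · refine Finset.sum_congr rfl fun i _ => ?_
      rw [barFace_quotients]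
      congr 1
      exact (hc _ _).symm
    · funext i
      simp [quotients, Fin.succAbove_last]
    · exact (hc _ _).symm

variable {Λ : Type*} [Group Λ] {ι : Λ →* Γ} {j : E →+* D} {σ : Γ →* D} {τ : Λ → E}

lemma toBar_scale_push (hσ : ∀ h, σ (ι h) = j (τ h)) (h : Λ) {n : ℕ}
    (y : (Fin (n + 1) → Γ) →₀ E) :
    toBar j σ n (scale (τ h) (push E (ι h * ·) _ y)) = toBar j σ n y := by
  induction y using Finsupp.induction_linear with
  | zero => simp
  | add y z hy hz => simp only [map_add, hy, hz]
  | single x e =>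
    rw [push_single, scale_single, toBar_single, toBar_single]
    congr 1
    · funext i
      simp [quotients, mul_assoc]
    · rw [map_mul, ← hσ, ← mul_assoc, ← map_mul]
      simp

lemma toBar_eq_zero_of_mem (hσ : ∀ h, σ (ι h) = j (τ h)) {n : ℕ} {y : (Fin (n + 1) → Γ) →₀ E}
    (hy : y ∈ orbitRel (fun h x => ι h * x) τ (n + 1)) : toBar j σ n y = 0 := by
  suffices orbitRel (fun h x => ι h * x) τ (n + 1) ≤ LinearMap.ker (toBar j σ n) from this hy
  refine Submodule.span_le.2 ?_
  rintro _ ⟨h, x, e, rfl⟩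
  rw [SetLike.mem_coe, LinearMap.mem_ker, map_sub, toBar_scale_push hσ, sub_self]

/-- The section of `toBar` attached to a section of the coefficients. -/
noncomputable def ofBar (θ : D →+ (Γ →₀ E)) (n : ℕ) :
    ((Fin n → Γ) →₀ D) →+ ((Fin (n + 1) → Γ) →₀ E) :=
  liftAddHom fun g => (mapDomain.addMonoidHom fun γ i => γ⁻¹ * Fin.partialProd g i).comp θ

variable {θ : D →+ (Γ →₀ E)}

lemma toBar_ofBar (hθ : ∀ d, ((θ d).sum fun γ e => σ γ * j e) = d) {n : ℕ}
    (y : (Fin n → Γ) →₀ D) : toBar j σ n (ofBar θ n y) = y := by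
  induction y using Finsupp.induction_linear with
  | zero => simp
  | add y z hy hz => simp only [map_add, hy, hz]
  | single g c =>
    rw [ofBar, liftAddHom_apply_single, AddMonoidHom.comp_apply, mapDomain.addMonoidHom_apply,
      mapDomain, Finsupp.sum, map_sum]
    have h1 : ∀ γ : Γ, quotients (fun i => γ⁻¹ * Fin.partialProd g i) = g := fun γ => by
      funext i
      simpa [quotients, mul_assoc] using Fin.partialProd_right_inv g i
    conv_rhs => rw [← hθ c, Finsupp.sum, ← singleAddHom_apply, map_sum]
    refine Finset.sum_congr rfl fun γ _ => ?_
    rw [toBar_single, h1]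
    simp

lemma sub_ofBar_toBar_mem
    (hθ : ∀ γ e, ∃ h, θ (σ γ * j e) = single (γ * (ι h)⁻¹) (τ h * e)) {n : ℕ}
    (y : (Fin (n + 1) → Γ) →₀ E) :
    ofBar θ n (toBar j σ n y) - y ∈ orbitRel (fun h x => ι h * x) τ (n + 1) := by
  induction y using Finsupp.induction_linear with
  | zero => simp
  | add y z hy hz =>
    rw [map_add, map_add, add_sub_add_comm]
    exact add_mem hy hz
  | single x e =>
    obtain ⟨h, hh⟩ := hθ (x 0)⁻¹ e
    refine Submodule.subset_span ⟨h, x, e, ?_⟩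
    rw [toBar_single, ofBar, liftAddHom_apply_single, AddMonoidHom.comp_apply,
      mapDomain.addMonoidHom_apply, hh, mapDomain_single, push_single, scale_single]
    congr 2
    funext i
    have := congrFun (Fin.partialProd_left_inv x) i
    simp only [Pi.smul_apply, smul_eq_mul] at this
    rw [Function.comp_apply, ← this]
    simp only [mul_inv_rev, inv_inv, mul_assoc]
    rfl

lemma mem_orbitRel_of_toBar_eq_zero
    (hθ : ∀ γ e, ∃ h, θ (σ γ * j e) = single (γ * (ι h)⁻¹) (τ h * e)) {n : ℕ}
    {y : (Fin (n + 1) → Γ) →₀ E} (hy : toBar j σ n y = 0) :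
    y ∈ orbitRel (fun h x => ι h * x) τ (n + 1) := by
  have := sub_ofBar_toBar_mem hθ y
  rwa [hy, map_zero, zero_sub, neg_mem_iff] at this

/-- The homology of the coinvariants of the homogeneous chains is the homology of the bar
complex. -/
lemma exists_addEquiv_toBar (hσ : ∀ h, σ (ι h) = j (τ h))
    (hθ : ∀ d, ((θ d).sum fun γ e => σ γ * j e) = d)
    (hθ' : ∀ γ e, ∃ h, θ (σ γ * j e) = single (γ * (ι h)⁻¹) (τ h * e)) (n : ℕ) :
    ∃ Φ : ↥((cycles (fun h x => ι h * x) τ n).map (boundaries (fun h x => ι h * x) τ n).mkQ) ≃+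
        ↥((barCycles σ n).map (LinearMap.range (barBoundary σ n)).mkQ),
      ∀ (r : Eᵐᵒᵖ) x, Φ (r • x) = RingHom.op j r • Φ x := by
  have hZ : ∀ z, z ∈ cycles (fun h x => ι h * x) τ n ↔ toBar j σ n z ∈ barCycles σ n := by
    intro z
    cases n with
    | zero => exact Iff.rfl
    | succ n =>
      change d E Γ n z ∈ orbitRel _ τ (n + 1) ↔ barBoundary σ n _ = 0
      rw [barBoundary_toBar]
      exact ⟨toBar_eq_zero_of_mem hσ, mem_orbitRel_of_toBar_eq_zero hθ'⟩
  refine Submodule.exists_addEquiv_map_mkQ (toBar j σ n) (fun z hz => (hZ z).1 hz)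
    (fun b hb => ?_) (fun z _ h => ?_) (fun z' hz' => ⟨ofBar θ n z', ?_, ?_⟩)
  · obtain ⟨_, ⟨a, rfl⟩, w, hw, rfl⟩ := Submodule.mem_sup.1 hb
    rw [map_add, toBar_eq_zero_of_mem hσ hw, add_zero, ← barBoundary_toBar]
    exact ⟨_, rfl⟩
  · obtain ⟨y, hy⟩ := h
    rw [← sub_add_cancel z (d E Γ n (ofBar θ _ y))]
    refine add_mem (Submodule.mem_sup_right (mem_orbitRel_of_toBar_eq_zero hθ' ?_))
      (Submodule.mem_sup_left ⟨_, rfl⟩)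
    rw [map_sub, ← barBoundary_toBar, toBar_ofBar hθ, hy, sub_self]
  · rwa [hZ, toBar_ofBar hθ]
  · rw [toBar_ofBar hθ, sub_self]
    exact zero_mem _

end Bar

end HomogeneousChains

/-- Restriction of scalars along an inclusion of finite degree multiplies the dimension of a
right module by the degree. -/
lemma toENat_rank_of_semilinear {T E D M M' : Type*} [Fintype T] [Ring E] [DivisionRing D]
    [StrongRankCondition Eᵐᵒᵖ] [AddCommGroup M] [Module Eᵐᵒᵖ M] [AddCommGroup M'] [Module Dᵐᵒᵖ M']
    (j : E →+* D) (b : T → D) (hb : Function.Bijective fun c : T → E => ∑ t, b t * j (c t))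
    (Φ : M ≃+ M') (hΦ : ∀ (r : Eᵐᵒᵖ) x, Φ (r • x) = RingHom.op j r • Φ x) :
    Cardinal.toENat (Module.rank Eᵐᵒᵖ M) =
      Fintype.card T * Cardinal.toENat (Module.rank Dᵐᵒᵖ M') := by
  let : Module Eᵐᵒᵖ Dᵐᵒᵖ := Module.compHom Dᵐᵒᵖ (RingHom.op j)
  let : Module Eᵐᵒᵖ M' := Module.compHom M' (RingHom.op j)
  have : IsScalarTower Eᵐᵒᵖ Dᵐᵒᵖ M' := ⟨fun r d m => mul_smul (RingHom.op j r) d m⟩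
  let f : (T → Eᵐᵒᵖ) →ₗ[Eᵐᵒᵖ] Dᵐᵒᵖ :=
    { toFun := fun c => MulOpposite.op (∑ t, b t * j (c t).unop)
      map_add' := fun c c' => by simp [mul_add, Finset.sum_add_distrib]
      map_smul' := fun r c => by
        change _ = RingHom.op j r * _
        refine MulOpposite.unop_injective ?_
        simp [Finset.sum_mul, mul_assoc] }
  have hf : Function.Bijective f := by
    constructor
    · intro c c' h
      have := hb.1 (a₁ := fun t => (c t).unop) (a₂ := fun t => (c' t).unop)
        (MulOpposite.op_injective h)
      exact funext fun t => MulOpposite.unop_injective (congrFun this t)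
    · intro d
      obtain ⟨c, hc⟩ := hb.2 d.unop
      exact ⟨fun t => MulOpposite.op (c t), MulOpposite.unop_injective hc⟩
  let B : Module.Basis T Eᵐᵒᵖ Dᵐᵒᵖ := Module.Basis.ofEquivFun (LinearEquiv.ofBijective f hf).symm
  have : Module.Free Eᵐᵒᵖ Dᵐᵒᵖ := Module.Free.of_basis B
  let e : M ≃ₗ[Eᵐᵒᵖ] M' := { Φ with map_smul' := hΦ }
  have h1 := congrArg Cardinal.toENat e.lift_rank_eq
  have h2 := congrArg Cardinal.toENat (lift_rank_mul_lift_rank Eᵐᵒᵖ Dᵐᵒᵖ M')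
  have h3 := congrArg Cardinal.toENat B.mk_eq_rank
  simp only [map_mul, Cardinal.toENat_lift, Cardinal.mk_fintype, map_natCast] at h1 h2 h3
  rw [h1, ← h2, ← h3]

lemma IsDivisionSubring.strongRankCondition_mulOpposite {R : Type*} [Ring R] [Nontrivial R]
    {S : Subring R} (hS : IsDivisionSubring S) : StrongRankCondition (↥S)ᵐᵒᵖ := by
  let : DivisionRing S := DivisionRing.ofIsUnitOrEqZero fun a => by
    by_cases ha : a = 0
    · exact Or.inr ha
    · obtain ⟨y, hy, h1, h2⟩ := hS a a.2 fun h => ha (Subtype.ext h)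
      exact Or.inl ⟨⟨a, ⟨y, hy⟩, Subtype.ext h1, Subtype.ext h2⟩, rfl⟩
  exact (inferInstance : StrongRankCondition (↥S)ᵐᵒᵖ)

namespace HomogeneousChains

open Finsupp

universe v w

variable {Γ : Type v} [Group Γ] (H : Subgroup Γ)

/-- An equivariant retraction of a group onto a subgroup. -/
lemma exists_equivariant_retraction : ∃ c : Γ → H, ∀ (h : H) x, c (h * x) = h * c x := by
  have hm : ∀ x : Γ, x * (QuotientGroup.mk x⁻¹ : Γ ⧸ H).out ∈ H := fun x => by
    have : ((QuotientGroup.mk x⁻¹ : Γ ⧸ H).out)⁻¹ * x⁻¹ ∈ H := by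
      rw [← QuotientGroup.eq, QuotientGroup.out_eq']
    rwa [← inv_mem_iff, mul_inv_rev]
  refine ⟨fun x => ⟨_, hm x⟩, fun h x => Subtype.ext ?_⟩
  have : (QuotientGroup.mk (h * x)⁻¹ : Γ ⧸ H) = QuotientGroup.mk x⁻¹ := by
    rw [QuotientGroup.eq]
    simp
  simp only [Subgroup.coe_mul, this, mul_assoc]

theorem index_mul_toENat_barHomologyRank [Fintype (Γ ⧸ H)] {E D : Type w} [Ring E]
    [DivisionRing D] [StrongRankCondition Eᵐᵒᵖ] (j : E →+* D) (σ : Γ →* D) (τ : H →* E)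
    (hσ : ∀ h : H, σ h = j (τ h))
    (hb : Function.Bijective fun c : Γ ⧸ H → E => ∑ t, σ t.out * j (c t)) (p : ℕ) :
    (H.index : ℕ∞) * Cardinal.toENat (barHomologyRank σ p) =
      Cardinal.toENat (barHomologyRank τ p) := by
  classical
  let B : (Γ ⧸ H → E) →+ D :=
    { toFun := fun c => ∑ t, σ t.out * j (c t)
      map_zero' := by simp
      map_add' := fun c c' => by simp [mul_add, Finset.sum_add_distrib] }
  let β : (Γ ⧸ H → E) ≃+ D := AddEquiv.ofBijective B hb
  have hβ : ∀ c, β c = ∑ t, σ t.out * j (c t) := fun c => rfl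
  let θ : D →+ (Γ →₀ E) :=
    { toFun := fun d => ∑ t, single t.out (β.symm d t)
      map_zero' := by simp
      map_add' := fun d d' => by simp [Finset.sum_add_distrib] }
  have hθ : ∀ c, θ (β c) = ∑ t, single t.out (c t) := fun c => by
    simp [θ]
  obtain ⟨Φ₁, h₁⟩ := exists_addEquiv_toBar (ι := MonoidHom.id H) (j := RingHom.id E) (σ := τ)
    (τ := τ) (θ := singleAddHom 1) (fun h => rfl) (fun d => by simp)
    (fun γ e => ⟨γ, by simp⟩) p
  obtain ⟨c, hc⟩ := exists_equivariant_retraction H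
  obtain ⟨Φ₂, h₂⟩ := exists_addEquiv_push (σ := τ) (act := fun h x => MonoidHom.id H h * x)
    (act' := fun h x => H.subtype h * x) (f := H.subtype) (g := c) (fun h x => map_mul _ _ _)
    hc p
  obtain ⟨Φ₃, h₃⟩ := exists_addEquiv_toBar (ι := H.subtype) (j := j) (σ := σ) (τ := τ) (θ := θ)
    hσ (fun d => by
      obtain ⟨c, rfl⟩ := β.surjective d
      rw [hθ, ← Finsupp.sum_finsetSum_index (by simp) (by simp [mul_add]), hβ]
      simp) (fun γ e => by
      have hm : (QuotientGroup.mk γ : Γ ⧸ H).out⁻¹ * γ ∈ H := by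
        rw [← QuotientGroup.eq, QuotientGroup.out_eq']
      refine ⟨⟨_, hm⟩, ?_⟩
      have : σ γ * j e = β (Pi.single (QuotientGroup.mk γ) (τ ⟨_, hm⟩ * e)) := by
        rw [hβ, Finset.sum_eq_single (QuotientGroup.mk γ)]
        · rw [Pi.single_eq_same, map_mul, ← hσ, ← mul_assoc, ← map_mul, mul_inv_cancel_left]
        · intro t _ ht
          rw [Pi.single_eq_of_ne ht, map_zero, mul_zero]
        · simp
      rw [this, hθ, Finset.sum_eq_single (QuotientGroup.mk γ)]
      · rw [Pi.single_eq_same]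
        congr 1
        simp
      · intro t _ ht
        rw [Pi.single_eq_of_ne ht, single_zero]
      · simp) p
  rw [barHomologyRank, barHomologyRank, Subgroup.index, Nat.card_eq_fintype_card]
  refine (toENat_rank_of_semilinear j _ hb (Φ₁.symm.trans (Φ₂.trans Φ₃)) fun r x => ?_).symm
  obtain ⟨y, rfl⟩ := Φ₁.surjective x
  have : r • Φ₁ y = Φ₁ (r • y) := (h₁ r y).symm
  rw [this]
  simp only [AddEquiv.trans_apply, AddEquiv.symm_apply_apply, h₂, h₃]

end HomogeneousChains

/-- **Agrarian Betti numbers scale under finite-index subgroups.**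
Let `k` be a field, `G` a locally indicable group with a Hughes-free embedding
`φ : kG → D`, and `H ≤ G` of finite index; let `E` be the division closure of `φ(kH)`
in `D` (so that the corestriction of `φ` to `kH → E` is a Hughes-free embedding).
Then `|G : H| · dim_D H_p(G; D) = dim_E H_p(H; E)` as extended natural numbers, the
homology being group homology with coefficients in `D` (resp. `E`) viewed as a left
module via `φ`, and the dimensions being over the right `D`- (resp. `E`-) vector space
structures. -/
theorem hughesFree_homology_scaling
    {k : Type u} [Field k] {G : Type v} [Group G] (hG : LocallyIndicable G)
    {D : Type w} [DivisionRing D] (φ : MonoidAlgebra k G →+* D)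
    (hφ : IsHughesFreeEmbedding φ)
    (H : Subgroup G) (hH : H.FiniteIndex) (p : ℕ) :
    (H.index : ℕ∞) *
        Cardinal.toENat (barHomologyRank (fun g : G => φ (MonoidAlgebra.of k G g)) p)
      = Cardinal.toENat
          (barHomologyRank
            (D := ↥(divisionClosure
              (Set.range (φ.comp (MonoidAlgebra.mapDomainRingHom k H.subtype)))))
            (fun h : H =>
              ⟨φ (MonoidAlgebra.of k G (h : G)),
                apply_of_mem_divisionClosure φ H h⟩) p) := by
  have := Fintype.ofFinite (G ⧸ H)
  have := H.normalCore.finite_quotient_of_finiteIndex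
  have hmem : ∀ x, x ∈ divisionClosure
      (Set.range (φ.comp (MonoidAlgebra.mapDomainRingHom k H.subtype))) ↔
        x ∈ MonoidAlgebra.divClosure φ H := fun x =>
    MonoidAlgebra.mem_divisionClosure_range_iff H.subtype H.range_subtype
  have hS : IsDivisionSubring (divisionClosure
      (Set.range (φ.comp (MonoidAlgebra.mapDomainRingHom k H.subtype)))) := fun x hx h0 =>
    ⟨x⁻¹, (hmem _).2 (inv_mem ((hmem _).1 hx)), mul_inv_cancel₀ h0, inv_mul_cancel₀ h0⟩
  have := hS.strongRankCondition_mulOpposite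
  refine HomogeneousChains.index_mul_toENat_barHomologyRank H (Subring.subtype _)
    ((φ : MonoidAlgebra k G →* D).comp (MonoidAlgebra.of k G))
    { toFun := fun h : H => ⟨φ (MonoidAlgebra.of k G h), apply_of_mem_divisionClosure φ H h⟩
      map_one' := Subtype.ext (by simp only [Subgroup.coe_one, map_one, Subring.coe_one])
      map_mul' := fun a b => Subtype.ext (by
        simp only [Subgroup.coe_mul, map_mul, Subring.coe_mul]) }
    (fun h => rfl) ⟨fun c c' h => funext fun t => Subtype.ext (sub_eq_zero.1 ?_), fun d => ?_⟩ p
  · refine MonoidAlgebra.sum_apply_out_mul_eq_zero (N := H.normalCore) hφ hG H.normalCore_le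
      (fun t => (c t : D) - c' t) (fun t => (hmem _).1 (sub_mem (c t).2 (c' t).2)) ?_ t
    simp only [mul_sub, Finset.sum_sub_distrib]
    exact sub_eq_zero.2 h
  · obtain ⟨e, he, h⟩ :=
      MonoidAlgebra.exists_sum_apply_out_mul (N := H.normalCore) hφ H.normalCore_le d
    exact ⟨fun t => ⟨e t, (hmem _).2 (he t)⟩, h⟩
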